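/- arXiv:1310.2930 — 2 statements merged into one kernel-verified Lean document; each statement's English description precedes it below -/
import Mathlib

section
/- Let ν be a corner-symmetric partition and let μ be a partition with ν ⊆ μ, |μ| = |ν| + 1, and μ ≠ ν + (1). Then μ does not cover ν. -/
/-- A partition, 0-indexed: `f i` is the `(i+1)`-st part. A partition is a weakly
decreasing, eventually zero function `ℕ → ℕ`. -/
def IsPartition (f : ℕ → ℕ) : Prop := Antitone f ∧ ∃ N, f N = 0

/-- The number of (nonzero) parts of a partition. -/
noncomputable def plen (f : ℕ → ℕ) : ℕ := sInf {n | f n = 0}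

/-- The size (weight) of a partition: the sum of its parts. -/
noncomputable def psize (f : ℕ → ℕ) : ℕ := ∑ i ∈ Finset.range (plen f), f i

/-- Containment of partitions: `subP f g` means `f ⊆ g`, i.e. `f i ≤ g i` for all `i`. -/
def subP (f g : ℕ → ℕ) : Prop := ∀ i, f i ≤ g i

/-- The conjugate partition: `conjP f j = #{i : f i > j}` (0-indexed). -/
noncomputable def conjP (f : ℕ → ℕ) : ℕ → ℕ := fun j => Nat.card {i : ℕ // j < f i}

/-- The square partition `(s^s)`. -/
def squareP (s : ℕ) : ℕ → ℕ := fun j => if j < s then s else 0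

/-- The partition `(s^s, 1)`: `s` parts equal to `s` followed by a part equal to `1`. -/
def squareP1 (s : ℕ) : ℕ → ℕ := fun j => if j < s then s else if j = s then 1 else 0

/-- The complement of `f` in the square `(m^m)`: the `(i+1)`-st part (0-indexed `i < m`)
is `m - f (m - 1 - i)`. -/
def complP (m : ℕ) (f : ℕ → ℕ) : ℕ → ℕ := fun i => if i < m then m - f (m - 1 - i) else 0

/-- `ν + (1)`: add one box at the end of the first row. -/
def addRow1 (f : ℕ → ℕ) : ℕ → ℕ := fun j => if j = 0 then f 0 + 1 else f j

/-- `(ν, 1)`: append a part equal to `1` after the last nonzero part. -/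
noncomputable def addPart1 (f : ℕ → ℕ) : ℕ → ℕ :=
  fun j => if j < plen f then f j else if j = plen f then 1 else 0

/-- Delete the first `k` columns of a partition. -/
def colDel (k : ℕ) (f : ℕ → ℕ) : ℕ → ℕ := fun j => f j - k

/-- Delete the first `s` rows of a partition. -/
def rowDel (s : ℕ) (f : ℕ → ℕ) : ℕ → ℕ := fun j => f (j + s)

/-- The sequence whose first `m` entries are given by `f` and whose subsequent entries
are given by `g`; used to form `(η^{c,m} + γ, σ)`. -/
def appendAfter (m : ℕ) (f g : ℕ → ℕ) : ℕ → ℕ := fun i => if i < m then f i else g (i - m)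

/-- The cell in row `r`, column `c` (both 0-indexed) belongs to the skew diagram
`lam/alpha`. -/
def inShape (lam alpha : ℕ → ℕ) (r c : ℕ) : Prop := alpha r ≤ c ∧ c < lam r

/-- A Littlewood–Richardson tableau of shape `lam/alpha` and content `beta`
(for each `k`, there are `beta k` entries equal to `k + 1`): a semistandard filling of
the skew diagram whose reverse reading word is a lattice permutation.  The lattice
condition is expressed by comparing, in every prefix of the reverse reading word ending
at a cell `(r, c)` (all cells in rows above `r`, together with the cells in row `r`
weakly to the right of column `c`), the number of entries `k + 2` with the number of
entries `k + 1`. -/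
structure LRTableau (lam alpha beta : ℕ → ℕ) where
  entry : ℕ → ℕ → ℕ
  zero_outside : ∀ r c, ¬ inShape lam alpha r c → entry r c = 0
  one_le : ∀ r c, inShape lam alpha r c → 1 ≤ entry r c
  row_weak : ∀ r c₁ c₂, c₁ ≤ c₂ → inShape lam alpha r c₁ → inShape lam alpha r c₂ →
    entry r c₁ ≤ entry r c₂
  col_strict : ∀ r₁ r₂ c, r₁ < r₂ → inShape lam alpha r₁ c → inShape lam alpha r₂ c →
    entry r₁ c < entry r₂ c
  content : ∀ k : ℕ,
    Nat.card {p : ℕ × ℕ // inShape lam alpha p.1 p.2 ∧ entry p.1 p.2 = k + 1} = beta k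
  lattice : ∀ r c k : ℕ, inShape lam alpha r c →
    Nat.card {p : ℕ × ℕ // inShape lam alpha p.1 p.2 ∧
        (p.1 < r ∨ (p.1 = r ∧ c ≤ p.2)) ∧ entry p.1 p.2 = k + 2} ≤
    Nat.card {p : ℕ × ℕ // inShape lam alpha p.1 p.2 ∧
        (p.1 < r ∨ (p.1 = r ∧ c ≤ p.2)) ∧ entry p.1 p.2 = k + 1}

open Classical in
/-- The Littlewood–Richardson coefficient `c^lam_{alpha, beta}`: the number of LR
tableaux of shape `lam/alpha` and content `beta`, or `0` if `alpha ⊄ lam`. -/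
noncomputable def LRcoeff (lam alpha beta : ℕ → ℕ) : ℕ :=
  if subP alpha lam then Nat.card (LRTableau lam alpha beta) else 0

/-- `mu` covers `nu`: for every integer `m ≥ μ₁ + ℓ(μ)` and every partition `lam`,
`c^lam_{ν^{c,m}, ν'} ≤ c^lam_{μ^{c,m}, μ'}`, i.e. `s_{μ'} s_{μ^c} - s_{ν'} s_{ν^c}`
is Schur-positive (complements taken in `(m^m)`). -/
def Covers (mu nu : ℕ → ℕ) : Prop :=
  ∀ m : ℕ, mu 0 + plen mu ≤ m → ∀ lam : ℕ → ℕ, IsPartition lam →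
    LRcoeff lam (complP m nu) (conjP nu) ≤ LRcoeff lam (complP m mu) (conjP mu)

/-- The partition `(i^{s+1}, i, i-1, ..., 2, 1)` (as a 0-indexed function). -/
def betaShape (i s : ℕ) : ℕ → ℕ := fun j => if j ≤ s + 1 then i else i + s + 1 - j

/-- A partition is of type 1 if it contains `(i, i, i-1, ..., 2, 1)` where `i` is its
first part. -/
def Type1 (nu : ℕ → ℕ) : Prop := IsPartition nu ∧ subP (betaShape (nu 0) 0) nu

/-- `nu = beta + (s^s) + alpha` (componentwise) is a type-2 decomposition: `s ≥ 1`,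
`alpha` is a nonempty partition with at most `s` parts, and `beta` is a (possibly empty)
partition containing `(i^{s+1}, i, i-1, ..., 2, 1)` where `i = beta 0`. -/
def IsType2Decomp (nu beta : ℕ → ℕ) (s : ℕ) (alpha : ℕ → ℕ) : Prop :=
  IsPartition beta ∧ IsPartition alpha ∧ 1 ≤ s ∧ alpha 0 ≠ 0 ∧ plen alpha ≤ s ∧
    subP (betaShape (beta 0) s) beta ∧ ∀ j, nu j = beta j + squareP s j + alpha j

/-- A partition is of type 2 if it admits a type-2 decomposition. -/
def Type2 (nu : ℕ → ℕ) : Prop := ∃ beta s alpha, IsType2Decomp nu beta s alpha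

/-- A self-conjugate partition. -/
def SelfConjugate (t : ℕ → ℕ) : Prop := ∀ j, conjP t j = t j

/-- A partition `nu` is corner-symmetric if for every outer corner of `nu` in row
`r + 1 ≥ 2` (1-indexed), i.e. every 0-indexed row `r ≥ 1` with `nu r < nu (r-1)`
(the corner cell lying in 0-indexed column `nu r`), there is a nonempty partition
`η ⊆ nu` such that the skew diagram `nu/η` is, up to translation, the Young diagram of
a self-conjugate partition, contains the cell `(r-1, nu r)` (0-indexed), and contains
no cell in any column of 0-indexed column index `< nu r`. -/
def CornerSymmetric (nu : ℕ → ℕ) : Prop :=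
  ∀ r : ℕ, 1 ≤ r → nu r < nu (r - 1) →
    ∃ η : ℕ → ℕ, IsPartition η ∧ subP η nu ∧ η 0 ≠ 0 ∧
      ∃ t : ℕ → ℕ, ∃ r0 c0 : ℕ, IsPartition t ∧ SelfConjugate t ∧
        (∀ a b : ℕ, (η a ≤ b ∧ b < nu a) ↔ (r0 ≤ a ∧ c0 ≤ b ∧ b - c0 < t (a - r0))) ∧
        η (r - 1) ≤ nu r ∧
        (∀ a b : ℕ, η a ≤ b → b < nu a → nu r ≤ b)

theorem IsPartition.lt_conjP_iff {f : ℕ → ℕ} (hf : IsPartition f) {i j : ℕ} :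
    i < conjP f j ↔ j < f i := by
  obtain ⟨hanti, N, hN⟩ := hf
  have hex : ∃ n, f n ≤ j := ⟨N, by omega⟩
  have key : ∀ i, j < f i ↔ i < Nat.find hex := by
    intro i
    constructor
    · intro h
      by_contra hc
      have h1 := hanti (not_lt.mp hc)
      have h2 := Nat.find_spec hex
      omega
    · intro h
      have := Nat.find_min hex h
      omega
  have hcard : conjP f j = Nat.find hex := by
    unfold conjP
    rw [Nat.card_congr (Equiv.subtypeEquivRight key)]
    simpa using Nat.card_congr (Fin.equivSubtype (n := Nat.find hex)).symm
  rw [hcard, key]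

theorem IsPartition.conjP_antitone {f : ℕ → ℕ} (hf : IsPartition f) : Antitone (conjP f) := by
  intro a b hab
  by_contra h
  have h1 := hf.lt_conjP_iff.mp (not_le.mp h)
  have h2 := mt hf.lt_conjP_iff.mpr (lt_irrefl (conjP f a))
  omega

theorem IsPartition.conjP_le_iff {f : ℕ → ℕ} (hf : IsPartition f) {i j : ℕ} :
    conjP f j ≤ i ↔ f i ≤ j := by
  rw [← not_lt, ← not_lt, hf.lt_conjP_iff]

theorem IsPartition.apply_plen {f : ℕ → ℕ} (hf : IsPartition f) : f (plen f) = 0 :=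
  Nat.sInf_mem (s := {n | f n = 0}) hf.2

theorem IsPartition.psize_eq_sum {f : ℕ → ℕ} (hf : IsPartition f) {N : ℕ} (hN : f N = 0) :
    psize f = ∑ i ∈ Finset.range N, f i := by
  have hle : plen f ≤ N := Nat.sInf_le hN
  refine Finset.sum_subset (Finset.range_mono hle) fun i _ hi => ?_
  have h1 := hf.1 (not_lt.mp (mt Finset.mem_range.mpr hi))
  have h2 := hf.apply_plen
  omega

/-- A partition containing `nu` and larger by one is obtained by adding one box. -/
theorem exists_row_of_psize_eq_succ {nu mu : ℕ → ℕ} (hnu : IsPartition nu)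
    (hmu : IsPartition mu) (hsub : subP nu mu) (hsz : psize mu = psize nu + 1) :
    ∃ r, mu r = nu r + 1 ∧ ∀ i, i ≠ r → mu i = nu i := by
  have hL := hmu.apply_plen
  set N := plen mu
  have hnL : nu N = 0 := by have := hsub N; omega
  rw [hmu.psize_eq_sum hL, hnu.psize_eq_sum hnL] at hsz
  have hdiff : ∑ i ∈ Finset.range N, (mu i - nu i) = 1 := by
    have : ∑ i ∈ Finset.range N, mu i =
        ∑ i ∈ Finset.range N, (mu i - nu i) + ∑ i ∈ Finset.range N, nu i := by
      rw [← Finset.sum_add_distrib]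
      refine Finset.sum_congr rfl fun i _ => ?_
      have := hsub i
      omega
    omega
  have hpos : ∃ r ∈ Finset.range N, mu r - nu r ≠ 0 := by
    by_contra! h
    rw [Finset.sum_eq_zero h] at hdiff
    omega
  obtain ⟨r, hr, hr0⟩ := hpos
  have hsplit := Finset.add_sum_erase (Finset.range N) (fun i => mu i - nu i) hr
  have hrest : ∑ i ∈ (Finset.range N).erase r, (mu i - nu i) = 0 := by omega
  refine ⟨r, by omega, fun i hi => ?_⟩
  have := hsub i
  by_cases hiN : i < N
  · have := Finset.sum_eq_zero_iff.mp hrest i (by simp [hi, hiN])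
    omega
  · have := hmu.1 (not_lt.mp hiN)
    omega

theorem finite_inShape {lam : ℕ → ℕ} (hlam : IsPartition lam) (alpha : ℕ → ℕ) :
    {p : ℕ × ℕ | inShape lam alpha p.1 p.2}.Finite := by
  obtain ⟨hanti, N, hN⟩ := hlam
  refine (Set.finite_Iio N |>.prod (Set.finite_Iio (lam 0))).subset ?_
  rintro ⟨a, b⟩ ⟨-, hb⟩
  simp only at hb
  refine ⟨?_, hb.trans_le (hanti (Nat.zero_le a))⟩
  by_contra hc
  have : lam a ≤ lam N := hanti (not_lt.mp hc)
  omega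

theorem LRTableau.entry_injective {lam alpha beta : ℕ → ℕ} :
    Function.Injective (LRTableau.entry : LRTableau lam alpha beta → ℕ → ℕ → ℕ) := by
  rintro ⟨e, _⟩ ⟨e', _⟩ h
  cases h
  rfl

theorem LRTableau.entry_le {lam alpha beta : ℕ → ℕ} (hlam : IsPartition lam) {K : ℕ}
    (hK : ∀ k, K ≤ k → beta k = 0) (T : LRTableau lam alpha beta) (a b : ℕ) :
    T.entry a b ≤ K := by
  by_contra! h
  have hs : inShape lam alpha a b := by
    by_contra hns
    have := T.zero_outside a b hns
    omega
  have hc := T.content (T.entry a b - 1)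
  rw [hK _ (by omega)] at hc
  have : Finite {p : ℕ × ℕ // inShape lam alpha p.1 p.2 ∧ T.entry p.1 p.2 =
      T.entry a b - 1 + 1} :=
    ((finite_inShape hlam alpha).subset fun p hp => hp.1 :
      {p : ℕ × ℕ | inShape lam alpha p.1 p.2 ∧ T.entry p.1 p.2 =
        T.entry a b - 1 + 1}.Finite)
  rw [Finite.card_eq_zero_iff] at hc
  exact hc.false ⟨(a, b), hs, by simp only; omega⟩

theorem LRTableau.finite {lam alpha beta : ℕ → ℕ} (hlam : IsPartition lam) {K : ℕ}
    (hK : ∀ k, K ≤ k → beta k = 0) : Finite (LRTableau lam alpha beta) := by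
  have hfin := finite_inShape hlam alpha
  have : Finite {p : ℕ × ℕ | inShape lam alpha p.1 p.2} := hfin
  let F : LRTableau lam alpha beta →
      ({p : ℕ × ℕ | inShape lam alpha p.1 p.2} → Fin (K + 1)) :=
    fun T p => ⟨T.entry p.1.1 p.1.2, Nat.lt_succ_of_le (T.entry_le hlam hK _ _)⟩
  refine Finite.of_injective F fun T T' h => LRTableau.entry_injective ?_
  funext a b
  by_cases hs : inShape lam alpha a b
  · simpa [F] using congrFun h ⟨(a, b), hs⟩
  · rw [T.zero_outside a b hs, T'.zero_outside a b hs]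

theorem LRTableau.entry_le_row_succ {lam alpha beta : ℕ → ℕ} (hlam : IsPartition lam)
    (T : LRTableau lam alpha beta) : ∀ a b, T.entry a b ≤ a + 1 := by
  intro a
  induction a using Nat.strong_induction_on with
  | _ a ih =>
    intro b
    by_contra! h
    have hs : inShape lam alpha a b := by
      by_contra hns
      have := T.zero_outside a b hns
      omega
    obtain ⟨k, hk⟩ : ∃ k, T.entry a b = k + 2 := ⟨T.entry a b - 2, by omega⟩
    have hl := T.lattice a b k hs
    have hfin : Finite {p : ℕ × ℕ // inShape lam alpha p.1 p.2 ∧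
        (p.1 < a ∨ (p.1 = a ∧ b ≤ p.2)) ∧ T.entry p.1 p.2 = k + 2} :=
      ((finite_inShape hlam alpha).subset fun p hp => hp.1 :
        {p : ℕ × ℕ | inShape lam alpha p.1 p.2 ∧
        (p.1 < a ∨ (p.1 = a ∧ b ≤ p.2)) ∧ T.entry p.1 p.2 = k + 2}.Finite)
    have hne : Nonempty {p : ℕ × ℕ // inShape lam alpha p.1 p.2 ∧
        (p.1 < a ∨ (p.1 = a ∧ b ≤ p.2)) ∧ T.entry p.1 p.2 = k + 2} :=
      ⟨⟨(a, b), hs, Or.inr ⟨rfl, le_rfl⟩, hk⟩⟩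
    have hpos := Nat.card_pos.trans_le hl
    obtain ⟨⟨⟨a', b'⟩, hs', hpre, hent⟩⟩ := (Nat.card_pos_iff.mp hpos).1
    simp only at hs' hpre hent
    rcases hpre with hlt | ⟨rfl, hle⟩
    · have := ih a' hlt b'
      omega
    · have := T.row_weak a' b b' hle hs hs'
      omega

/-- `lam` is an outer shape witnessing that adding a box in row `r` does not give a cover:
the complement of `eta` in `(m^m)`, with the first `c` parts of `beta` added on the right and
the remaining ones, truncated to `r0`, added below. -/
def witness (m c r0 : ℕ) (eta beta : ℕ → ℕ) : ℕ → ℕ := fun i =>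
  if i < m then m - eta (m - 1 - i) + (if i < c then beta i else 0)
  else min r0 (beta (c + (i - m)))

/-- The rows `r0, …, r - 1` of `nu`, with the first `nu r` columns deleted, form a
self-conjugate partition with diagram `nu / eta`. -/
structure SelfConjugateCorner (nu eta : ℕ → ℕ) (r r0 : ℕ) : Prop where
  part : IsPartition nu
  anti : Antitone eta
  sub : ∀ a, eta a ≤ nu a
  lt : r0 < r
  corner : nu r < nu (r - 1)
  top : nu r0 = nu r + (r - r0)
  cell : ∀ a b, b < nu a → (eta a ≤ b ↔ r0 ≤ a ∧ nu r ≤ b)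
  conj : ∀ k, conjP nu (nu r + k) - r0 = nu (r0 + k) - nu r

theorem CornerSymmetric.exists_corner {nu : ℕ → ℕ} (hnu : IsPartition nu)
    (hcs : CornerSymmetric nu) {r : ℕ} (hr : 1 ≤ r) (hlt : nu r < nu (r - 1)) :
    ∃ eta r0, SelfConjugateCorner nu eta r r0 := by
  obtain ⟨eta, heta, hsub, -, t, r0, c0, ht, htc, hcell, hη, hcol⟩ := hcs r hr hlt
  have h1 := (hcell (r - 1) (nu r)).mp ⟨hη, hlt⟩
  obtain ⟨h1a, h1b, h1c⟩ := h1
  have hc : c0 = nu r := by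
    have h2 := (hcell (r - 1) c0).mpr ⟨h1a, le_rfl, by omega⟩
    have := hcol _ _ h2.1 h2.2
    omega
  subst hc
  have htr : t (r - r0) = 0 := by
    by_contra h
    have := (hcell r (nu r)).mpr ⟨by omega, le_rfl, by omega⟩
    omega
  have htn : ∀ k, nu (r0 + k) - nu r = t k := by
    intro k
    by_cases hk : r0 + k < r
    · have hpos : 0 < t k := by
        have := ht.1 (show k ≤ r - 1 - r0 by omega)
        omega
      have hx := (hcell (r0 + k) (nu r)).mpr ⟨by omega, le_rfl, by
        rw [Nat.add_sub_cancel_left]; omega⟩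
      have hy := (hcell (r0 + k) (nu r + t k - 1)).mpr ⟨by omega, by omega, by
        rw [Nat.add_sub_cancel_left]; omega⟩
      have hz := (hcell (r0 + k) (nu r + t k))
      rw [Nat.add_sub_cancel_left, Nat.add_sub_cancel_left] at hz
      have : ¬ (nu r + t k < nu (r0 + k)) := fun h =>
        absurd (hz.mp ⟨by omega, h⟩).2.2 (lt_irrefl _)
      omega
    · have h3 := hnu.1 (not_lt.mp hk)
      have h4 := ht.1 (show r - r0 ≤ k by omega)
      omega
  have hconj : ∀ k, conjP nu (nu r + k) - r0 = nu (r0 + k) - nu r := by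
    intro k
    rw [htn, ← htc k]
    refine eq_of_forall_lt_iff fun i => ?_
    rw [ht.lt_conjP_iff, Nat.lt_sub_iff_add_lt, hnu.lt_conjP_iff, ← htn i, add_comm i r0]
    omega
  have hcr : conjP nu (nu r) = r := by
    have h5 := (hnu.lt_conjP_iff (i := r - 1)).mpr hlt
    have h6 := (hnu.conjP_le_iff (i := r)).mpr le_rfl
    omega
  have h0 := hconj 0
  rw [Nat.add_zero, Nat.add_zero, hcr] at h0
  refine ⟨eta, r0, hnu, heta.1, hsub, by omega, hlt, by omega, fun a b hb => ?_, hconj⟩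
  have h7 := hcell a b
  constructor
  · intro h
    exact ⟨(h7.mp ⟨h, hb⟩).1, (h7.mp ⟨h, hb⟩).2.1⟩
  · rintro ⟨h8, h9⟩
    have := htn (a - r0)
    rw [Nat.add_sub_cancel' h8] at this
    exact (h7.mpr ⟨h8, h9, by omega⟩).1

namespace SelfConjugateCorner

variable {nu eta : ℕ → ℕ} {r r0 : ℕ}

theorem conjP_corner (h : SelfConjugateCorner nu eta r r0) : conjP nu (nu r) = r := by
  have h5 := (h.part.lt_conjP_iff (i := r - 1)).mpr h.corner
  have h6 := (h.part.conjP_le_iff (i := r)).mpr le_rfl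
  omega

theorem isPartition_witness (h : SelfConjugateCorner nu eta r r0) {m : ℕ}
    (hm : nu 0 + conjP nu 0 ≤ m) : IsPartition (witness m (nu r) r0 eta (conjP nu)) := by
  have hca := h.part.conjP_antitone
  refine ⟨antitone_nat_of_succ_le fun i => ?_, m + nu 0, ?_⟩
  · have h1 := h.anti (show m - 1 - (i + 1) ≤ m - 1 - i by omega)
    have h2 := hca (show i ≤ i + 1 by omega)
    have h3 := hca (show nu r + (i - m) ≤ nu r + (i + 1 - m) by omega)
    have h4 := h.anti (Nat.zero_le (m - 1 - i))
    have h5 := h.sub 0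
    have h6 := hca (Nat.zero_le (nu r))
    have h7 := h.conjP_corner
    have h8 := h.lt
    unfold witness
    grind
  · have h1 : conjP nu (nu r + (m + nu 0 - m)) = 0 := by
      have := (h.part.conjP_le_iff (i := 0) (j := nu r + (m + nu 0 - m))).mpr (by omega)
      omega
    unfold witness
    rw [if_neg (by omega), h1, Nat.min_zero]

/-- No tableau survives after adding the box: there are too few columns to hold the entries
equal to `nu r + 1`. -/
theorem isEmpty_lrTableau (h : SelfConjugateCorner nu eta r r0) {mu : ℕ → ℕ}
    (hmu : IsPartition mu) (hr : mu r = nu r + 1) (hother : ∀ i, i ≠ r → mu i = nu i) {m : ℕ}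
    (hm : nu 0 + conjP nu 0 ≤ m) :
    IsEmpty (LRTableau (witness m (nu r) r0 eta (conjP nu)) (complP m mu) (conjP mu)) := by
  refine ⟨fun T => ?_⟩
  have hlam := h.isPartition_witness hm
  have hcm : conjP mu (nu r) = r + 1 := by
    have h5 := (hmu.lt_conjP_iff (i := r) (j := nu r)).mpr (by omega)
    have h6 := (hmu.conjP_le_iff (i := r + 1) (j := nu r)).mpr (by
      rw [hother _ (by omega)]; exact h.part.1 (by omega))
    omega
  have hcont := T.content (nu r)
  rw [hcm] at hcont
  set S := Finset.range r0 ∪ Finset.Ico (m - nu r0) (m - nu r) with hS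
  have hScard : S.card ≤ r := by
    refine (Finset.card_union_le _ _).trans ?_
    rw [Finset.card_range, Nat.card_Ico]
    have := h.top
    have := h.lt
    omega
  let f : {p : ℕ × ℕ // inShape (witness m (nu r) r0 eta (conjP nu)) (complP m mu) p.1 p.2 ∧
      T.entry p.1 p.2 = nu r + 1} → S := fun p => ⟨p.1.2, by
    obtain ⟨⟨a, b⟩, ⟨hs1, hs2⟩, he⟩ := p
    have hrow := T.entry_le_row_succ hlam a b
    simp only at hs1 hs2 he ⊢
    simp only [hS, Finset.mem_union, Finset.mem_range, Finset.mem_Ico]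
    unfold witness at hs2
    unfold complP at hs1
    by_cases ham : a < m
    · rw [if_pos ham, if_neg (show ¬ a < nu r by omega)] at hs2
      rw [if_pos ham] at hs1
      right
      have hn0 := h.part.1 (Nat.zero_le (m - 1 - a))
      have hrc := h.part.1 (Nat.zero_le r)
      have htop := h.part.1 (Nat.zero_le r0)
      have hr0 := h.lt
      have ht := h.top
      by_cases har : m - 1 - a = r
      · rw [har] at hs1 hs2
        have h1 : eta r = nu r := by
          by_contra hne
          have h2 := h.sub r
          have h3 := (h.cell r (eta r) (by omega)).mp le_rfl
          omega
        omega
      · rw [hother _ har] at hs1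
        have hsub := h.sub (m - 1 - a)
        have h1 := (h.cell (m - 1 - a) (m - 1 - b) (by omega)).mp (by omega)
        have h2 := h.part.1 h1.1
        omega
    · rw [if_neg ham] at hs2
      left
      omega⟩
  have hinj : Function.Injective f := by
    rintro ⟨⟨a, b⟩, hs, he⟩ ⟨⟨a', b'⟩, hs', he'⟩ hab
    have hb : b = b' := congrArg Subtype.val hab
    subst hb
    simp only at hs hs' he he'
    rcases lt_trichotomy a a' with hlt | rfl | hlt
    · have := T.col_strict a a' b hlt hs hs'
      omega
    · rfl
    · have := T.col_strict a' a b hlt hs' hs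
      omega
  have := Nat.card_le_card_of_injective f hinj
  rw [hcont, Nat.card_eq_fintype_card, Fintype.card_coe] at this
  omega

open Classical in
/-- The filling whose columns to the left of column `m` contain `nu r + 1, nu r + 2, …` and whose
remaining columns contain `1, 2, …`. -/
noncomputable def filling (nu eta : ℕ → ℕ) (r r0 m a b : ℕ) : ℕ :=
  if inShape (witness m (nu r) r0 eta (conjP nu)) (complP m nu) a b then
    if b < m then a + 1 + nu r + conjP nu (m - 1 - b) - m else a + 1
  else 0

theorem sub_conjP_le_row (h : SelfConjugateCorner nu eta r r0) {m a b : ℕ} (hb : b < m)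
    (ha : complP m nu a ≤ b) : m ≤ a + conjP nu (m - 1 - b) := by
  unfold complP at ha
  by_cases ham : a < m
  · rw [if_pos ham] at ha
    have := (h.part.lt_conjP_iff (i := m - 1 - a) (j := m - 1 - b)).mpr (by omega)
    omega
  · omega

theorem complP_le_of (h : SelfConjugateCorner nu eta r r0) {m a b : ℕ}
    (ha : b < m → m ≤ a + conjP nu (m - 1 - b)) : complP m nu a ≤ b := by
  unfold complP
  by_cases ham : a < m
  · rw [if_pos ham]
    by_cases hb : b < m
    · have := (h.part.lt_conjP_iff (i := m - 1 - a) (j := m - 1 - b)).mp (by have := ha hb; omega)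
      omega
    · omega
  · simp [ham]

theorem le_row_of_lt (h : SelfConjugateCorner nu eta r r0) {m a b : ℕ}
    (hm : nu 0 + conjP nu 0 ≤ m) (hb : b < m) (ha : complP m nu a ≤ b) : nu r ≤ a := by
  have h1 := h.sub_conjP_le_row hb ha
  have h2 := h.part.conjP_antitone (Nat.zero_le (m - 1 - b))
  have h3 := h.part.1 (Nat.zero_le r)
  omega

theorem row_lt_of_le (h : SelfConjugateCorner nu eta r r0) {m a b : ℕ}
    (hm : nu 0 + conjP nu 0 ≤ m) (hb : m ≤ b)
    (ha : b < witness m (nu r) r0 eta (conjP nu) a) :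
    a < nu r := by
  have h7 := h.conjP_corner
  have h8 := h.lt
  have h9 := h.part.conjP_antitone (Nat.zero_le (nu r))
  have h10 := (h.part.lt_conjP_iff (i := 0) (j := nu r)).mp (by omega)
  unfold witness at ha
  grind

theorem lt_witness_iff_of_row_lt (h : SelfConjugateCorner nu eta r r0) {m a b : ℕ}
    (hm : nu 0 + conjP nu 0 ≤ m) (ha : a < nu r) :
    b < witness m (nu r) r0 eta (conjP nu) a ↔ b < m + conjP nu a := by
  have h1 := h.part.1 (Nat.zero_le r)
  have h2 := h.anti (Nat.zero_le (m - 1 - a))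
  have h3 : eta (m - 1 - a) = 0 := by
    have h4 := (h.part.conjP_le_iff (i := m - 1 - a) (j := 0)).mp (by omega)
    have := h.sub (m - 1 - a)
    omega
  unfold witness
  rw [if_pos (by omega), if_pos ha, h3]
  simp

/-- Columns carrying an entry equal to `nu r + 1 + k`, left of column `m`. -/
theorem lt_witness_iff_of_lt (h : SelfConjugateCorner nu eta r r0) {m k b : ℕ}
    (hm : nu 0 + conjP nu 0 ≤ m) (hb : b < m) :
    b < witness m (nu r) r0 eta (conjP nu) (k + m - conjP nu (m - 1 - b)) ↔
      b < min r0 (conjP nu (nu r + k)) ∨ m - nu (r0 + k) ≤ b ∧ b < m - nu r := by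
  have h1 := h.part.1 (Nat.zero_le r)
  have h2 := h.part.conjP_antitone (Nat.zero_le (m - 1 - b))
  have h3 := h.part.1 (Nat.zero_le (r0 + k))
  have h4 := h.part.conjP_antitone (Nat.zero_le (nu r))
  have h5 := h.conjP_corner
  have h6 := h.lt
  have hlt := h.part.lt_conjP_iff (i := r0 + k) (j := m - 1 - b)
  unfold witness
  by_cases hk : k < conjP nu (m - 1 - b)
  · rw [if_pos (by omega), if_neg (by omega), Nat.add_zero]
    have ha : m - 1 - (k + m - conjP nu (m - 1 - b)) = conjP nu (m - 1 - b) - 1 - k := by omega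
    rw [ha]
    have h7 := (h.part.lt_conjP_iff (i := conjP nu (m - 1 - b) - 1 - k)
      (j := m - 1 - b)).mp (by omega)
    have h8 := h.cell _ _ h7
    have h9 := (h.part.lt_conjP_iff (i := 0)).mp (Nat.zero_lt_of_lt hk)
    omega
  · rw [if_neg (by omega)]
    by_cases hz : conjP nu (m - 1 - b) = 0
    · rw [hz]
      have : nu r + (k + m - 0 - m) = nu r + k := by omega
      rw [this]
      omega
    · have h9 := (h.part.lt_conjP_iff (i := 0)).mp (Nat.pos_of_ne_zero hz)
      omega

theorem card_filling_eq_of_lt (h : SelfConjugateCorner nu eta r r0) {m k : ℕ}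
    (hm : nu 0 + conjP nu 0 ≤ m) (hk : k < nu r) :
    Nat.card {p : ℕ × ℕ // inShape (witness m (nu r) r0 eta (conjP nu)) (complP m nu) p.1 p.2 ∧
      filling nu eta r r0 m p.1 p.2 = k + 1} = conjP nu k := by
  have hset : {p : ℕ × ℕ | inShape (witness m (nu r) r0 eta (conjP nu)) (complP m nu) p.1 p.2 ∧
      filling nu eta r r0 m p.1 p.2 = k + 1} =
      ((Finset.Ico m (m + conjP nu k)).image (fun b => (k, b)) : Finset (ℕ × ℕ)) := by
    ext ⟨a, b⟩
    simp only [Set.mem_ofPred_eq, Finset.coe_image, Set.mem_image,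
      Finset.mem_coe, Finset.mem_Ico, Prod.mk.injEq]
    constructor
    · rintro ⟨hs, he⟩
      rw [filling, if_pos hs] at he
      by_cases hb : b < m
      · rw [if_pos hb] at he
        have := h.sub_conjP_le_row hb hs.1
        omega
      · rw [if_neg hb] at he
        obtain rfl : a = k := by omega
        exact ⟨b, ⟨by omega, (h.lt_witness_iff_of_row_lt hm hk).mp hs.2⟩, rfl, rfl⟩
    · rintro ⟨b, ⟨hb1, hb2⟩, rfl, rfl⟩
      have hs : inShape (witness m (nu r) r0 eta (conjP nu)) (complP m nu) k b :=
        ⟨h.complP_le_of fun _ => by omega, (h.lt_witness_iff_of_row_lt hm hk).mpr hb2⟩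
      refine ⟨hs, ?_⟩
      rw [filling, if_pos hs, if_neg (by omega)]
  change Nat.card ({p : ℕ × ℕ | _} : Set (ℕ × ℕ)) = _
  rw [Nat.card_coe_set_eq, hset, Set.ncard_coe_finset,
    Finset.card_image_of_injective _ fun x y hxy => (Prod.ext_iff.mp hxy).2, Nat.card_Ico]
  omega

theorem card_filling_eq_of_le (h : SelfConjugateCorner nu eta r r0) {m k : ℕ}
    (hm : nu 0 + conjP nu 0 ≤ m) :
    Nat.card {p : ℕ × ℕ // inShape (witness m (nu r) r0 eta (conjP nu)) (complP m nu) p.1 p.2 ∧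
      filling nu eta r r0 m p.1 p.2 = nu r + k + 1} = conjP nu (nu r + k) := by
  have h1 := h.part.1 (Nat.zero_le (r0 + k))
  have h4 := h.part.conjP_antitone (Nat.zero_le (nu r))
  have h5 := h.conjP_corner
  have h6 := h.lt
  have hset : {p : ℕ × ℕ | inShape (witness m (nu r) r0 eta (conjP nu)) (complP m nu) p.1 p.2 ∧
      filling nu eta r r0 m p.1 p.2 = nu r + k + 1} =
      ((Finset.range (min r0 (conjP nu (nu r + k))) ∪
        Finset.Ico (m - nu (r0 + k)) (m - nu r)).image
        (fun b => (k + m - conjP nu (m - 1 - b), b)) :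
        Finset (ℕ × ℕ)) := by
    ext ⟨a, b⟩
    simp only [Set.mem_ofPred_eq, Finset.coe_image, Set.mem_image,
      Finset.mem_coe, Finset.mem_union, Finset.mem_range, Finset.mem_Ico, Prod.mk.injEq]
    constructor
    · rintro ⟨hs, he⟩
      rw [filling, if_pos hs] at he
      by_cases hb : b < m
      · rw [if_pos hb] at he
        have h7 := h.sub_conjP_le_row hb hs.1
        obtain rfl : a = k + m - conjP nu (m - 1 - b) := by omega
        exact ⟨b, (h.lt_witness_iff_of_lt hm hb).mp hs.2, rfl, rfl⟩
      · rw [if_neg hb] at he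
        have := h.row_lt_of_le hm (not_lt.mp hb) hs.2
        omega
    · rintro ⟨b, hb, rfl, rfl⟩
      have hbm : b < m := by omega
      have h7 := h.part.conjP_antitone (Nat.zero_le (m - 1 - b))
      have hs : inShape (witness m (nu r) r0 eta (conjP nu)) (complP m nu)
          (k + m - conjP nu (m - 1 - b)) b :=
        ⟨h.complP_le_of fun _ => by omega, (h.lt_witness_iff_of_lt hm hbm).mpr hb⟩
      refine ⟨hs, ?_⟩
      rw [filling, if_pos hs, if_pos hbm]
      omega
  change Nat.card ({p : ℕ × ℕ | _} : Set (ℕ × ℕ)) = _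
  rw [Nat.card_coe_set_eq, hset, Set.ncard_coe_finset, 
    Finset.card_image_of_injective _ fun x y hxy => (Prod.ext_iff.mp hxy).2,
    Finset.card_union_of_disjoint, Finset.card_range, Nat.card_Ico]
  · have := h.conj k
    have := h.part.1 (Nat.zero_le r)
    omega
  · rw [Finset.disjoint_left]
    intro x hx hx'
    simp only [Finset.mem_range, Finset.mem_Ico] at hx hx'
    omega

/-- Send a cell with entry `k + 2` to a cell with entry `k + 1` in a higher row. -/
def raise (nu : ℕ → ℕ) (r r0 m k : ℕ) (p : ℕ × ℕ) : ℕ × ℕ :=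
  if p.2 < m ∧ k + 1 = nu r then
    (k, m + if p.2 < r0 then p.2 else p.2 - (m - nu r0) + r0)
  else (p.1 - 1, p.2)

theorem raise_spec (h : SelfConjugateCorner nu eta r r0) {m k : ℕ}
    (hm : nu 0 + conjP nu 0 ≤ m) {p : ℕ × ℕ}
    (hs : inShape (witness m (nu r) r0 eta (conjP nu)) (complP m nu) p.1 p.2)
    (he : filling nu eta r r0 m p.1 p.2 = k + 2) :
    inShape (witness m (nu r) r0 eta (conjP nu)) (complP m nu) (raise nu r r0 m k p).1
        (raise nu r r0 m k p).2 ∧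
      (raise nu r r0 m k p).1 < p.1 ∧
      filling nu eta r r0 m (raise nu r r0 m k p).1 (raise nu r r0 m k p).2 = k + 1 := by
  have hlam := h.isPartition_witness hm
  obtain ⟨a, b⟩ := p
  simp only at hs he
  rw [filling, if_pos hs] at he
  have hab : b < m → m ≤ a + conjP nu (m - 1 - b) := fun hb => h.sub_conjP_le_row hb hs.1
  by_cases hc : b < m ∧ k + 1 = nu r
  · obtain ⟨hb, hk⟩ := hc
    simp only [raise, hb, hk, and_self, if_true]
    rw [if_pos hb] at he
    have hka : k < a := by
      have := h.le_row_of_lt hm hb hs.1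
      omega
    obtain rfl : a = 0 + m - conjP nu (m - 1 - b) := by have := hab hb; omega
    have hcol := (h.lt_witness_iff_of_lt hm hb).mp hs.2
    have h0 := h.conjP_corner
    have h1 := h.part.conjP_antitone (show k ≤ nu r by omega)
    have ht := h.top
    have hr0 := h.lt
    have hn := h.part.1 (Nat.zero_le r0)
    have hin : inShape (witness m (nu r) r0 eta (conjP nu)) (complP m nu) k
        (m + if b < r0 then b else b - (m - nu r0) + r0) := by
      refine ⟨h.complP_le_of fun hb => by omega,
        (h.lt_witness_iff_of_row_lt hm (by omega)).mpr ?_⟩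
      simp only [Nat.add_zero] at hcol
      split_ifs <;> omega
    refine ⟨hin, hka, ?_⟩
    rw [filling, if_pos hin, if_neg (by omega), hk]
  · rw [raise, if_neg hc]
    simp only
    have ha : 1 ≤ a := by
      by_contra ha
      split_ifs at he with hb
      · have h2 := h.le_row_of_lt hm hb hs.1
        have h3 := h.part.conjP_antitone (Nat.zero_le (m - 1 - b))
        omega
      · omega
    have hin : inShape (witness m (nu r) r0 eta (conjP nu)) (complP m nu) (a - 1) b := by
      refine ⟨h.complP_le_of fun hb => ?_, hs.2.trans_le (hlam.1 (Nat.sub_le a 1))⟩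
      rw [if_pos hb] at he
      have := hab hb
      omega
    refine ⟨hin, by omega, ?_⟩
    rw [filling, if_pos hin]
    split_ifs at he ⊢ <;> omega

theorem raise_injOn (h : SelfConjugateCorner nu eta r r0) {m k : ℕ}
    (hm : nu 0 + conjP nu 0 ≤ m) {p q : ℕ × ℕ}
    (hp : inShape (witness m (nu r) r0 eta (conjP nu)) (complP m nu) p.1 p.2)
    (hep : filling nu eta r r0 m p.1 p.2 = k + 2)
    (hq : inShape (witness m (nu r) r0 eta (conjP nu)) (complP m nu) q.1 q.2)
    (heq : filling nu eta r r0 m q.1 q.2 = k + 2)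
    (hpq : raise nu r r0 m k p = raise nu r r0 m k q) : p = q := by
  have hlp := (h.raise_spec hm hp hep).2.1
  have hlq := (h.raise_spec hm hq heq).2.1
  obtain ⟨a, b⟩ := p
  obtain ⟨a', b'⟩ := q
  have hn := h.part.1 (Nat.zero_le r)
  have ht := h.part.1 (Nat.zero_le r0)
  simp only at hp hq hep heq hlp hlq
  rw [filling, if_pos hp] at hep
  rw [filling, if_pos hq] at heq
  have hab : b < m → m ≤ a + conjP nu (m - 1 - b) := fun hb => h.sub_conjP_le_row hb hp.1
  have hab' : b' < m → m ≤ a' + conjP nu (m - 1 - b') := fun hb => h.sub_conjP_le_row hb hq.1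
  simp only [raise] at hpq hlp hlq
  by_cases hc : b < m ∧ k + 1 = nu r
  · rw [if_pos hc] at hpq
    rw [if_pos hc.1] at hep
    have hcol := h.lt_witness_iff_of_lt (k := 0) hm hc.1
    rw [show 0 + m - conjP nu (m - 1 - b) = a by have := hab hc.1; omega] at hcol
    have hcol := hcol.mp hp.2
    simp only [Nat.add_zero] at hcol
    by_cases hc' : b' < m ∧ k + 1 = nu r
    · rw [if_pos hc'] at hpq
      rw [if_pos hc'.1] at heq
      have hcol' := h.lt_witness_iff_of_lt (k := 0) hm hc'.1
      rw [show 0 + m - conjP nu (m - 1 - b') = a' by have := hab' hc'.1; omega] at hcol'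
      have hcol' := hcol'.mp hq.2
      simp only [Nat.add_zero] at hcol'
      have h1 := (Prod.ext_iff.mp hpq).2
      simp only at h1
      obtain rfl : b = b' := by split_ifs at h1 <;> omega
      obtain rfl : a = a' := by
        have := hab hc.1
        have := hab' hc.1
        omega
      rfl
    · exfalso
      rw [if_neg hc'] at hpq
      have h1 := (Prod.ext_iff.mp hpq).1
      have h2 := (Prod.ext_iff.mp hpq).2
      simp only at h1 h2
      rw [if_neg (by omega)] at heq
      have := h.row_lt_of_le hm (by omega) hq.2
      omega
  · rw [if_neg hc] at hpq hlp
    by_cases hc' : b' < m ∧ k + 1 = nu r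
    · exfalso
      rw [if_pos hc'] at hpq
      have h1 := (Prod.ext_iff.mp hpq).1
      have h2 := (Prod.ext_iff.mp hpq).2
      simp only at h1 h2
      rw [if_neg (by omega)] at hep
      have := h.row_lt_of_le hm (by omega) hp.2
      omega
    · rw [if_neg hc'] at hpq hlq
      have h1 := (Prod.ext_iff.mp hpq).1
      have h2 := (Prod.ext_iff.mp hpq).2
      simp only at h1 h2 hlp hlq
      exact Prod.ext (by simp only; omega) h2

theorem nonempty_lrTableau (h : SelfConjugateCorner nu eta r r0) {m : ℕ}
    (hm : nu 0 + conjP nu 0 ≤ m) :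
    Nonempty (LRTableau (witness m (nu r) r0 eta (conjP nu)) (complP m nu) (conjP nu)) := by
  have hlam := h.isPartition_witness hm
  refine ⟨⟨filling nu eta r r0 m, fun a b hs => if_neg hs, ?_, ?_, ?_, ?_, ?_⟩⟩
  · intro a b hs
    rw [filling, if_pos hs]
    split_ifs with hb
    · have := h.sub_conjP_le_row hb hs.1
      omega
    · omega
  · intro a b c hbc hb hc
    rw [filling, if_pos hb, filling, if_pos hc]
    by_cases hbm : b < m
    · by_cases hcm : c < m
      · have h1 := h.part.conjP_antitone (show m - 1 - c ≤ m - 1 - b by omega)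
        rw [if_pos hbm, if_pos hcm]
        omega
      · have h1 := h.le_row_of_lt hm hbm hb.1
        have h2 := h.row_lt_of_le hm (not_lt.mp hcm) hc.2
        omega
    · rw [if_neg hbm, if_neg (by omega)]
  · intro a a' b haa ha ha'
    rw [filling, if_pos ha, filling, if_pos ha']
    split_ifs with hb
    · have := h.sub_conjP_le_row hb ha.1
      omega
    · omega
  · intro k
    by_cases hk : k < nu r
    · exact h.card_filling_eq_of_lt hm hk
    · obtain ⟨j, rfl⟩ := Nat.exists_eq_add_of_le (not_lt.mp hk)
      exact h.card_filling_eq_of_le hm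
  · intro a b k _
    have hfin : Finite {p : ℕ × ℕ // inShape (witness m (nu r) r0 eta (conjP nu))
        (complP m nu) p.1 p.2 ∧ (p.1 < a ∨ (p.1 = a ∧ b ≤ p.2)) ∧
        filling nu eta r r0 m p.1 p.2 = k + 1} :=
      ((finite_inShape hlam (complP m nu)).subset fun p hp => hp.1 :
        {p : ℕ × ℕ | inShape (witness m (nu r) r0 eta (conjP nu))
        (complP m nu) p.1 p.2 ∧ (p.1 < a ∨ (p.1 = a ∧ b ≤ p.2)) ∧
        filling nu eta r r0 m p.1 p.2 = k + 1}.Finite)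
    refine Nat.card_le_card_of_injective (fun p => ⟨raise nu r r0 m k p.1, ?_⟩) ?_
    · obtain ⟨h1, h2, h3⟩ := h.raise_spec hm p.2.1 p.2.2.2
      have := p.2.2.1
      exact ⟨h1, Or.inl (by omega), h3⟩
    · intro p q hpq
      exact Subtype.ext (h.raise_injOn hm p.2.1 p.2.2.2 q.2.1 q.2.2.2 (congrArg Subtype.val hpq))

theorem subP_witness (h : SelfConjugateCorner nu eta r r0) {m : ℕ} :
    subP (complP m nu) (witness m (nu r) r0 eta (conjP nu)) := by
  intro i
  have := h.sub (m - 1 - i)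
  unfold complP witness
  split_ifs <;> omega

end SelfConjugateCorner

/-- a corner-symmetric partition `ν` is not covered by any partition
`μ ⊇ ν` with `|μ| = |ν| + 1` other than `ν + (1)`. -/
theorem corner_symmetric_not_covered (nu mu : ℕ → ℕ)
    (hnu : IsPartition nu) (hcs : CornerSymmetric nu)
    (hmu : IsPartition mu) (hsub : subP nu mu) (hsz : psize mu = psize nu + 1)
    (hne : mu ≠ addRow1 nu) :
    ¬ Covers mu nu := by
  intro hcov
  obtain ⟨r, hr, hother⟩ := exists_row_of_psize_eq_succ hnu hmu hsub hsz
  have hr1 : 1 ≤ r := by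
    by_contra h0
    obtain rfl : r = 0 := by omega
    refine hne (funext fun j => ?_)
    unfold addRow1
    split_ifs with hj
    · rw [hj, hr]
    · exact hother j hj
  have hlt : nu r < nu (r - 1) := by
    have h1 := hmu.1 (Nat.sub_le r 1)
    rw [hother (r - 1) (by omega)] at h1
    omega
  obtain ⟨eta, r0, h⟩ := hcs.exists_corner hnu hr1 hlt
  have hm : nu 0 + conjP nu 0 ≤ mu 0 + plen mu := by
    have h1 := hmu.apply_plen
    have h2 := (hnu.conjP_le_iff (i := plen mu) (j := 0)).mpr (by have := hsub (plen mu); omega)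
    have h3 := hsub 0
    omega
  have hlam := h.isPartition_witness hm
  have hle := hcov _ le_rfl _ hlam
  have hempty := h.isEmpty_lrTableau hmu hr hother hm
  have hnonempty := h.nonempty_lrTableau hm
  have hfin : Finite (LRTableau (witness (mu 0 + plen mu) (nu r) r0 eta (conjP nu))
      (complP (mu 0 + plen mu) nu) (conjP nu)) :=
    LRTableau.finite hlam (K := nu 0) fun k hk =>
      Nat.le_zero.mp (hnu.conjP_le_iff.mpr hk)
  have hpos := Nat.card_pos (α := LRTableau (witness (mu 0 + plen mu) (nu r) r0 eta (conjP nu))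
      (complP (mu 0 + plen mu) nu) (conjP nu))
  rw [LRcoeff, if_pos h.subP_witness, LRcoeff] at hle
  simp only [Nat.card_of_isEmpty, ite_self] at hle
  omega
end

section
/- Let ν = (s^s) + α where s ≥ 1 and α is a nonempty partition with ℓ(α) ≤ s, and let μ be a partition with ν ⊆ μ and |μ| = |ν| + 1. Then μ covers ν if and only if μ = (ν, 1), the partition obtained from ν by appending a part equal to 1 (equivalently, μ = (s^s, 1) + α). -/
/-- The cells weakly before `(r, c)` in the reverse reading order. -/
def readBefore (r c : ℕ) (p : ℕ × ℕ) : Prop := p.1 < r ∨ (p.1 = r ∧ c ≤ p.2)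

instance (r c : ℕ) : DecidablePred (readBefore r c) := fun p =>
  inferInstanceAs (Decidable (p.1 < r ∨ (p.1 = r ∧ c ≤ p.2)))

/-- The number of cells of `F` where the filling `e` takes the value `v`. -/
def entryCount (F : Finset (ℕ × ℕ)) (e : ℕ → ℕ → ℕ) (v : ℕ) : ℕ :=
  (F.filter fun x => e x.1 x.2 = v).card

theorem entryCount_pos {F : Finset (ℕ × ℕ)} {e : ℕ → ℕ → ℕ} {v r c : ℕ} (h : (r, c) ∈ F)
    (hv : e r c = v) : 1 ≤ entryCount F e v :=
  Finset.card_pos.2 ⟨(r, c), Finset.mem_filter.2 ⟨h, hv⟩⟩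

theorem exists_of_entryCount_pos {F : Finset (ℕ × ℕ)} {e : ℕ → ℕ → ℕ} {v : ℕ}
    (h : 1 ≤ entryCount F e v) : ∃ r c, (r, c) ∈ F ∧ e r c = v := by
  obtain ⟨x, hx⟩ := Finset.card_pos.1 h
  exact ⟨x.1, x.2, Finset.mem_filter.1 hx⟩

theorem entryCount_eq_zero {F : Finset (ℕ × ℕ)} {e : ℕ → ℕ → ℕ} {v : ℕ}
    (h : ∀ r c, (r, c) ∈ F → e r c ≠ v) : entryCount F e v = 0 := by
  by_contra hne
  obtain ⟨r, c, hF, hv⟩ := exists_of_entryCount_pos (Nat.pos_of_ne_zero hne)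
  exact h r c hF hv

theorem exists_box {lam : ℕ → ℕ} (hlam : IsPartition lam) :
    ∃ B : Finset (ℕ × ℕ), ∀ r c, c < lam r → (r, c) ∈ B := by
  obtain ⟨hanti, N, hN⟩ := hlam
  refine ⟨Finset.range N ×ˢ Finset.range (lam 0), fun r c hc => ?_⟩
  have h0 := hanti (Nat.zero_le r)
  simp only [Finset.mem_product, Finset.mem_range]
  refine ⟨?_, by omega⟩
  by_contra hr
  have := hanti (not_lt.1 hr)
  omega

theorem natCard_eq_entryCount {lam al : ℕ → ℕ} {e : ℕ → ℕ → ℕ} {B : Finset (ℕ × ℕ)}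
    (hB : ∀ r c, c < lam r → (r, c) ∈ B) (he : ∀ r c, ¬ inShape lam al r c → e r c = 0)
    (P : ℕ × ℕ → Prop) [DecidablePred P] (v : ℕ) :
    Nat.card {p : ℕ × ℕ // inShape lam al p.1 p.2 ∧ P p ∧ e p.1 p.2 = v + 1} =
      entryCount (B.filter P) e (v + 1) := by
  refine Nat.subtype_card _ fun p => ?_
  simp only [Finset.mem_filter]
  constructor
  · rintro ⟨⟨-, hP⟩, hv⟩
    refine ⟨?_, hP, hv⟩
    by_contra hs
    rw [he _ _ hs] at hv
    omega
  · rintro ⟨hs, hP, hv⟩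
    exact ⟨⟨hB _ _ hs.2, hP⟩, hv⟩

theorem natCard_eq_entryCount' {lam al : ℕ → ℕ} {e : ℕ → ℕ → ℕ} {B : Finset (ℕ × ℕ)}
    (hB : ∀ r c, c < lam r → (r, c) ∈ B) (he : ∀ r c, ¬ inShape lam al r c → e r c = 0)
    (v : ℕ) :
    Nat.card {p : ℕ × ℕ // inShape lam al p.1 p.2 ∧ e p.1 p.2 = v + 1} =
      entryCount B e (v + 1) := by
  have := natCard_eq_entryCount hB he (fun _ => True) v
  simpa using this

theorem exists_last_read (S : Finset (ℕ × ℕ)) (hS : S.Nonempty) :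
    ∃ r c, (r, c) ∈ S ∧ ∀ x ∈ S, readBefore r c x := by
  obtain ⟨d, hd, hmax⟩ := S.exists_max_image
    (fun p => (toLex (p.1, OrderDual.toDual p.2) : ℕ ×ₗ ℕᵒᵈ)) hS
  refine ⟨d.1, d.2, hd, fun x hx => ?_⟩
  have := hmax x hx
  rw [Prod.Lex.le_iff] at this
  simpa [readBefore] using this

namespace LRTableau

variable {lam al be : ℕ → ℕ} (T : LRTableau lam al be)

theorem inShape_of_entry {r c : ℕ} (h : T.entry r c ≠ 0) : inShape lam al r c := by
  by_contra hs
  exact h (T.zero_outside r c hs)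

theorem entryCount_box {B : Finset (ℕ × ℕ)} (hB : ∀ r c, c < lam r → (r, c) ∈ B) (k : ℕ) :
    entryCount B T.entry (k + 1) = be k := by
  rw [← T.content k, natCard_eq_entryCount' hB T.zero_outside]

theorem lattice_entryCount {B : Finset (ℕ × ℕ)} (hB : ∀ r c, c < lam r → (r, c) ∈ B)
    (r c k : ℕ) :
    entryCount (B.filter (readBefore r c)) T.entry (k + 2) ≤
      entryCount (B.filter (readBefore r c)) T.entry (k + 1) := by
  set S := B.filter (fun x => T.entry x.1 x.2 ≠ 0 ∧ readBefore r c x) with hS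
  have key : ∀ v, entryCount (B.filter (readBefore r c)) T.entry (v + 1) =
      entryCount S T.entry (v + 1) := by
    intro v
    unfold entryCount
    congr 1
    ext x
    simp only [hS, Finset.mem_filter]
    constructor
    · rintro ⟨⟨h1, h2⟩, h3⟩
      exact ⟨⟨h1, by omega, h2⟩, h3⟩
    · rintro ⟨⟨h1, -, h2⟩, h3⟩
      exact ⟨⟨h1, h2⟩, h3⟩
  rw [key, key]
  rcases S.eq_empty_or_nonempty with h0 | hne
  · simp [h0, entryCount]
  obtain ⟨r', c', hmem, hlast⟩ := exists_last_read S hne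
  have hmem' := Finset.mem_filter.1 hmem
  have key' : ∀ v, entryCount (B.filter (readBefore r' c')) T.entry (v + 1) =
      entryCount S T.entry (v + 1) := by
    intro v
    unfold entryCount
    congr 1
    ext x
    simp only [hS, Finset.mem_filter]
    constructor
    · rintro ⟨⟨h1, h2⟩, h3⟩
      refine ⟨⟨h1, by omega, ?_⟩, h3⟩
      have := hmem'.2.2
      simp only [readBefore] at this h2 ⊢
      omega
    · rintro ⟨⟨h1, h0, h2⟩, h3⟩
      exact ⟨⟨h1, hlast x (Finset.mem_filter.2 ⟨h1, h0, h2⟩)⟩, h3⟩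
  have := T.lattice r' c' k (T.inShape_of_entry hmem'.2.1)
  rw [← key', ← key']
  have e := fun v => natCard_eq_entryCount hB T.zero_outside (readBefore r' c') v
  rw [← e, ← e]
  exact this

theorem entry_add_le (hlam : IsPartition lam) (r₀ : ℕ)
    (h : ∀ r < r₀, ∀ c, ¬ inShape lam al r c) (r c : ℕ) (hs : inShape lam al r c) :
    T.entry r c + r₀ ≤ r + 1 := by
  obtain ⟨B, hB⟩ := exists_box hlam
  induction r using Nat.strong_induction_on generalizing c with
  | _ r ih =>
    have hs' : inShape lam al r (lam r - 1) := by unfold inShape at *; omega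
    have hle := T.row_weak r c (lam r - 1) (by unfold inShape at hs; omega) hs hs'
    have hr : r₀ ≤ r := by
      by_contra hlt
      exact h r (not_le.1 hlt) c hs
    by_contra hcon
    obtain ⟨k, hk⟩ : ∃ k, T.entry r (lam r - 1) = k + 2 :=
      ⟨T.entry r (lam r - 1) - 2, by omega⟩
    have h1 : 1 ≤ entryCount (B.filter (readBefore r (lam r - 1))) T.entry (k + 2) :=
      entryCount_pos (Finset.mem_filter.2 ⟨hB _ _ hs'.2, Or.inr ⟨rfl, le_rfl⟩⟩) hk
    obtain ⟨r1, c1, hm, hv⟩ :=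
      exists_of_entryCount_pos (h1.trans (T.lattice_entryCount hB r (lam r - 1) k))
    have hs1 := T.inShape_of_entry (r := r1) (c := c1) (by omega)
    rcases (Finset.mem_filter.1 hm).2 with hlt | ⟨heq, hc⟩
    · have := ih r1 hlt c1 hs1
      simp only at hlt
      omega
    · simp only at heq hc
      subst heq
      have : c1 = lam r1 - 1 := by unfold inShape at hs1; omega
      subst this
      omega

theorem ext_entry {T U : LRTableau lam al be} (h : T.entry = U.entry) : T = U := by
  cases T; cases U; simp_all

theorem finite_s14 (hlam : IsPartition lam) : Finite (LRTableau lam al be) := by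
  obtain ⟨B, hB⟩ := exists_box hlam
  refine Finite.of_injective (β := ∀ x : B, Fin (x.1.1 + 2))
    (fun T x => ⟨T.entry x.1.1 x.1.2, ?_⟩) ?_
  · by_cases hs : inShape lam al x.1.1 x.1.2
    · have := T.entry_add_le hlam 0 (by simp) _ _ hs
      omega
    · rw [T.zero_outside _ _ hs]; omega
  · intro T U hTU
    refine ext_entry (funext fun r => funext fun c => ?_)
    by_cases hs : inShape lam al r c
    · have := congrFun hTU ⟨(r, c), hB _ _ hs.2⟩
      simpa using this
    · rw [T.zero_outside _ _ hs, U.zero_outside _ _ hs]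

end LRTableau

/-- Builds a Littlewood–Richardson tableau from conditions on `entryCount`. -/
def LRTableau.ofEntryCount {lam al be : ℕ → ℕ} {B : Finset (ℕ × ℕ)}
    (hB : ∀ r c, c < lam r → (r, c) ∈ B) (e : ℕ → ℕ → ℕ)
    (zero_outside : ∀ r c, ¬ inShape lam al r c → e r c = 0)
    (one_le : ∀ r c, inShape lam al r c → 1 ≤ e r c)
    (row_weak : ∀ r c₁ c₂, c₁ ≤ c₂ → inShape lam al r c₁ → inShape lam al r c₂ →
      e r c₁ ≤ e r c₂)
    (col_strict : ∀ r₁ r₂ c, r₁ < r₂ → inShape lam al r₁ c → inShape lam al r₂ c →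
      e r₁ c < e r₂ c)
    (content : ∀ k, entryCount B e (k + 1) = be k)
    (lattice : ∀ r c k, entryCount (B.filter (readBefore r c)) e (k + 2) ≤
      entryCount (B.filter (readBefore r c)) e (k + 1)) :
    LRTableau lam al be where
  entry := e
  zero_outside := zero_outside
  one_le := one_le
  row_weak := row_weak
  col_strict := col_strict
  content k := by rw [natCard_eq_entryCount' hB zero_outside, content]
  lattice r c k _ := by
    have h := fun v => natCard_eq_entryCount hB zero_outside (readBefore r c) v
    simp only [readBefore] at h
    rw [h, h]
    exact lattice r c k

theorem entryCount_eq_sum (F : Finset (ℕ × ℕ)) (e : ℕ → ℕ → ℕ) (v : ℕ) :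
    entryCount F e v = ∑ x ∈ F, if e x.1 x.2 = v then 1 else 0 :=
  Finset.card_filter _ _

theorem sum_ite_eq_and (F : Finset (ℕ × ℕ)) (y : ℕ × ℕ) (q : Prop) [Decidable q] :
    (∑ x ∈ F, if x = y ∧ q then 1 else 0) = if y ∈ F ∧ q then 1 else 0 := by
  by_cases hq : q <;> simp [hq]

/-- Skew shapes `lam/al` and `lam/al'`, where `al'` is `al` with one cell removed from the end
of row `b`, together with contents `be` and `be'`, where `be'` has one more entry `1` than `be`.
The rows of `al` up to row `b` have the maximal length `b + 1 + s`, the `s` rows after that are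
shorter by at least `s`, and then `al` ends. -/
structure BoxRemoval (s b : ℕ) (lam al al' be be' : ℕ → ℕ) : Prop where
  pos : 1 ≤ s
  le : s ≤ b
  part : IsPartition lam
  anti : Antitone al
  sub : subP al lam
  top : ∀ r ≤ b, al r = b + 1 + s
  low : ∀ r, b < r → al r ≤ b + 1
  bot : al (b + 1 + s) = 0
  be_lt : ∀ k < s, be k = s
  be_pos : 1 ≤ be s
  be_le : be s ≤ s
  al' : ∀ r, al' r = if r = b then b + s else al r
  be' : ∀ k, be' k = if k = 0 then be 0 + 1 else be k

namespace BoxRemoval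

variable {s b : ℕ} {lam al al' be be' : ℕ → ℕ}

theorem lt_row (h : BoxRemoval s b lam al al' be be') : b + s < lam b := by
  have h1 := h.sub b
  have h2 := h.top b le_rfl
  omega

theorem inShape_iff (h : BoxRemoval s b lam al al' be be')
    (r c : ℕ) :
    inShape lam al' r c ↔ inShape lam al r c ∨ (r = b ∧ c = b + s) := by
  have h1 := h.lt_row
  have h2 := h.top b le_rfl
  have h3 := h.al' r
  unfold inShape
  split_ifs at h3 with hr
  · subst hr; omega
  · omega

theorem inShape_low (h : BoxRemoval s b lam al al' be be')
    {r c : ℕ} (hr : b < r) :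
    inShape lam al' r c ↔ inShape lam al r c := by
  rw [h.inShape_iff]; constructor
  · rintro (h1 | h1)
    · exact h1
    · omega
  · exact Or.inl

theorem not_inShape_new (h : BoxRemoval s b lam al al' be be') :
    ¬ inShape lam al b (b + s) := by
  have := h.top b le_rfl
  unfold inShape
  omega

theorem exists_add_one (h : BoxRemoval s b lam al al' be be')
    (T : LRTableau lam al be) (hT : T.entry (b + 1) (b + s) ≠ 1) :
    ∃ U : LRTableau lam al' be',
      U.entry = fun r c => if r = b ∧ c = b + s then 1 else T.entry r c := by
  obtain ⟨B, hB⟩ := exists_box h.part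
  have hnew : T.entry b (b + s) = 0 := T.zero_outside _ _ h.not_inShape_new
  have hcount : ∀ (F : Finset (ℕ × ℕ)) (k : ℕ),
      entryCount F (fun r c => if r = b ∧ c = b + s then 1 else T.entry r c) (k + 1) =
        entryCount F T.entry (k + 1) + if (b, b + s) ∈ F ∧ k = 0 then 1 else 0 := by
    intro F k
    rw [entryCount_eq_sum, entryCount_eq_sum, ← sum_ite_eq_and, ← Finset.sum_add_distrib]
    refine Finset.sum_congr rfl fun x _ => ?_
    obtain ⟨r, c⟩ := x
    by_cases hx : r = b ∧ c = b + s
    · obtain ⟨rfl, rfl⟩ := hx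
      simp [hnew]
    · have : ¬ ((r, c) = (b, b + s)) := by simpa using hx
      simp [hx, this]
  refine ⟨LRTableau.ofEntryCount hB
    (fun r c => if r = b ∧ c = b + s then 1 else T.entry r c) ?_ ?_ ?_ ?_ ?_ ?_, rfl⟩
  · intro r c hs
    rw [h.inShape_iff] at hs
    push Not at hs
    rw [if_neg (fun hx => hs.2 hx.1 hx.2)]
    exact T.zero_outside _ _ hs.1
  · intro r c hs
    split_ifs with hx
    · exact le_rfl
    · exact T.one_le _ _ (((h.inShape_iff r c).1 hs).resolve_right hx)
  · intro r c₁ c₂ hc h1 h2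
    have htop := h.top b le_rfl
    rw [h.inShape_iff] at h1 h2
    split_ifs with hx1 hx2 hx2
    · exact le_rfl
    · exact T.one_le _ _ (h2.resolve_right hx2)
    · have := h1.resolve_right hx1
      obtain ⟨rfl, rfl⟩ := hx2
      unfold inShape at this
      omega
    · exact T.row_weak _ _ _ hc (h1.resolve_right hx1) (h2.resolve_right hx2)
  · intro r₁ r₂ c hr h1 h2
    rw [h.inShape_iff] at h1 h2
    split_ifs with hx1 hx2 hx2
    · omega
    · have hs2 := h2.resolve_right hx2
      obtain ⟨rfl, rfl⟩ := hx1
      have hs1 : inShape lam al (r₁ + 1) (r₁ + s) := by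
        have e1 := h.low (r₁ + 1) (by omega)
        have e2 := h.part.1 (show r₁ + 1 ≤ r₂ by omega)
        have e3 := h.pos
        unfold inShape at *
        omega
      have := T.one_le _ _ hs1
      rcases (show r₁ + 1 ≤ r₂ by omega).eq_or_lt with heq | hlt
      · subst heq; omega
      · have := T.col_strict _ _ _ hlt hs1 hs2
        omega
    · have := h1.resolve_right hx1
      have e := h.top r₁ (by omega)
      unfold inShape at this
      omega
    · exact T.col_strict _ _ _ hr (h1.resolve_right hx1) (h2.resolve_right hx2)
  · intro k
    have : (b, b + s) ∈ B := hB _ _ h.lt_row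
    rw [hcount, T.entryCount_box hB, h.be']
    split_ifs <;> simp_all
  · intro r c k
    rw [hcount, hcount, if_neg (by omega)]
    exact (T.lattice_entryCount hB r c k).trans (Nat.le_add_right _ _)

theorem entry_eq_iff (h : BoxRemoval s b lam al al' be be')
    (T : LRTableau lam al be) (h0 : lam 0 ≤ b + 1 + s) (p : ℕ)
    (hp : ∀ j, 1 ≤ j → j ≤ p → b + 1 + s ≤ lam (b + j)) (j : ℕ) (hj : 1 ≤ j) (hjp : j ≤ p) :
    j ≤ s ∧ ∀ r c, T.entry r c = j ↔ r = b + j ∧ b + 1 ≤ c ∧ c < b + 1 + s := by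
  obtain ⟨B, hB⟩ := exists_box h.part
  induction j using Nat.strong_induction_on with
  | _ j ih =>
    have hjs : j ≤ s + 1 := by
      by_cases h1 : j = 1
      · omega
      · have := (ih (j - 1) (by omega) (by omega) (by omega)).1
        omega
    have hlam : lam (b + j) = b + 1 + s :=
      le_antisymm ((h.part.1 (Nat.zero_le _)).trans h0) (hp j hj hjp)
    have hrow : ∀ c, inShape lam al (b + j) c → T.entry (b + j) c = j := by
      intro c hc
      have h1 := T.one_le _ _ hc
      have h2 := T.entry_add_le h.part (b + 1) (fun r hr c hs => by
        have e1 := h.top r (by omega)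
        have e2 := h.part.1 (Nat.zero_le r)
        unfold inShape at hs
        omega) _ _ hc
      by_contra hne
      have h3 := ((ih _ (show T.entry (b + j) c < j by omega) h1 (by omega)).2 (b + j) c).1 rfl
      omega
    have hcard := T.entryCount_box hB (j - 1)
    rw [Nat.sub_add_cancel hj, entryCount] at hcard
    have hlow := h.low (b + j) (by omega)
    rcases Nat.lt_or_ge s j with hlt | hle
    · exfalso
      obtain rfl : j = s + 1 := by omega
      have hsubset : ({b + (s + 1)} ×ˢ Finset.range (b + 1 + s) : Finset (ℕ × ℕ)) ⊆
          B.filter fun x => T.entry x.1 x.2 = s + 1 := by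
        rintro ⟨r, c⟩ hx
        simp only [Finset.mem_product, Finset.mem_singleton, Finset.mem_range] at hx
        obtain ⟨rfl, hc⟩ := hx
        have hbot := h.bot
        rw [show b + 1 + s = b + (s + 1) by omega] at hbot
        exact Finset.mem_filter.2 ⟨hB _ _ (by omega), hrow c ⟨by omega, by omega⟩⟩
      have := Finset.card_le_card hsubset
      have e := h.be_le
      simp only [Nat.add_sub_cancel] at hcard
      rw [hcard] at this
      simp at this
      omega
    · refine ⟨hle, fun r c => ?_⟩
      have hsubset : ({b + j} ×ˢ Finset.Ico (b + 1) (b + 1 + s) : Finset (ℕ × ℕ)) ⊆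
          B.filter fun x => T.entry x.1 x.2 = j := by
        rintro ⟨r, c⟩ hx
        simp only [Finset.mem_product, Finset.mem_singleton, Finset.mem_Ico] at hx
        obtain ⟨rfl, hc⟩ := hx
        exact Finset.mem_filter.2 ⟨hB _ _ (by omega), hrow c ⟨by omega, by omega⟩⟩
      have heq := Finset.eq_of_subset_of_card_le hsubset (by
        rw [hcard, h.be_lt _ (by omega)]; simp)
      have hmem := congrArg (fun S => (r, c) ∈ S) heq
      simp only [Finset.mem_product, Finset.mem_singleton, Finset.mem_Ico, Finset.mem_filter,
        eq_iff_iff] at hmem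
      constructor
      · intro hv
        exact hmem.2 ⟨hB _ _ (T.inShape_of_entry (by omega)).2, hv⟩
      · intro hv
        exact (hmem.1 hv).2

/-- The entries `1, …, p` of column `b + s` in the rows after `b` are moved up by one row and
followed by `p + 1`, and the entry of the cell `(d₁, d₂)` becomes `1`. -/
def shiftEntry (b s p d₁ d₂ : ℕ) (e : ℕ → ℕ → ℕ) (r c : ℕ) : ℕ :=
  if c = b + s ∧ b ≤ r ∧ r ≤ b + p then r - b + 1 else if r = d₁ ∧ c = d₂ then 1 else e r c

theorem exists_shift (h : BoxRemoval s b lam al al' be be') (T : LRTableau lam al be)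
    (h0 : lam 0 ≤ b + 1 + s) (p : ℕ) (hp1 : 1 ≤ p)
    (hp : ∀ j, 1 ≤ j → j ≤ p → b + 1 + s ≤ lam (b + j)) (hlast : lam (b + p + 1) < b + 1 + s) :
    ∃ d₁ d₂, b + p < d₁ ∧ T.entry d₁ d₂ = p + 1 ∧
      ∃ U : LRTableau lam al' be', U.entry = shiftEntry b s p d₁ d₂ T.entry := by
  obtain ⟨B, hB⟩ := exists_box h.part
  have hpos := h.pos
  have hE := h.entry_eq_iff T h0 p hp
  have hps : p ≤ s := (hE p hp1 le_rfl).1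
  have hE2 : ∀ j, 1 ≤ j → j ≤ p → ∀ r c, T.entry r c = j ↔ r = b + j ∧ b + 1 ≤ c ∧ c < b + 1 + s :=
    fun j h1 h2 => (hE j h1 h2).2
  clear hE
  have hlam0 : ∀ r, lam r ≤ b + 1 + s := fun r => (h.part.1 (Nat.zero_le r)).trans h0
  have hhigh : ∀ r c, inShape lam al r c → b + p < r → p + 1 ≤ T.entry r c := by
    intro r c hs hr
    by_contra hlt
    have := (hE2 _ (T.one_le _ _ hs) (by omega) r c).1 rfl
    omega
  have hlow : ∀ r c, p + 1 ≤ T.entry r c → b + p < r := by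
    intro r c hv
    by_contra hr
    have hs := T.inShape_of_entry (r := r) (c := c) (by omega)
    have := T.entry_add_le h.part (b + 1) (fun r hr c hs => by
        have e1 := h.top r (by omega)
        have e2 := hlam0 r
        unfold inShape at hs
        omega) _ _ hs
    omega
  have hcard := T.entryCount_box hB p
  have hbe1 : 1 ≤ be p := by
    rcases hps.eq_or_lt with rfl | hlt
    · exact h.be_pos
    · rw [h.be_lt _ hlt]; exact hpos
  have hbe2 : be p ≤ s := by
    rcases hps.eq_or_lt with rfl | hlt
    · exact h.be_le
    · rw [h.be_lt _ hlt]
  obtain ⟨d₁, d₂, hd, hdlast⟩ := exists_last_read (B.filter fun x => T.entry x.1 x.2 = p + 1)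
    (Finset.card_pos.1 (by rw [entryCount] at hcard; omega))
  obtain ⟨hdB, hdv⟩ := Finset.mem_filter.1 hd
  simp only at hdv
  have hlastd : ∀ r c, T.entry r c = p + 1 → r < d₁ ∨ (r = d₁ ∧ d₂ ≤ c) := fun r c hv =>
    hdlast (r, c) (Finset.mem_filter.2 ⟨hB _ _ (T.inShape_of_entry (by omega)).2, hv⟩)
  have hds := T.inShape_of_entry (r := d₁) (c := d₂) (by omega)
  have hd1 : b + p < d₁ := hlow d₁ d₂ (by omega)
  have hlamd : lam d₁ < b + 1 + s :=
    (h.part.1 (show b + p + 1 ≤ d₁ by omega)).trans_lt hlast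
  have habove : ∀ r, r < d₁ → ¬ inShape lam al' r d₂ := by
    intro r hr hs
    have hs' : inShape lam al r d₂ := by
      rcases (h.inShape_iff r d₂).1 hs with h1 | h1
      · exact h1
      · unfold inShape at hds; omega
    have hs1 : inShape lam al (d₁ - 1) d₂ := by
      have e1 := h.anti (show r ≤ d₁ - 1 by omega)
      have e2 := h.part.1 (show d₁ - 1 ≤ d₁ by omega)
      unfold inShape at *
      omega
    have h1 := T.one_le _ _ hs1
    have h2 := T.col_strict _ _ _ (show d₁ - 1 < d₁ by omega) hs1 hds
    have h3 := (hE2 _ h1 (by omega) _ _).1 rfl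
    rcases hps.eq_or_lt with heq | hlt
    · have hs0 : inShape lam al d₁ 0 := by
        have e := h.bot
        rw [show b + 1 + s = d₁ by omega] at e
        unfold inShape at *
        omega
      have e1 := T.row_weak d₁ 0 d₂ (Nat.zero_le _) hs0 hds
      have e2 := hhigh _ _ hs0 hd1
      have e3 := hlastd d₁ 0 (by omega)
      omega
    · have hsubset : (B.filter fun x => T.entry x.1 x.2 = p + 1) ⊆
          {d₁} ×ˢ Finset.Ico (b + 1) (b + s) := by
        rintro ⟨r', c'⟩ hx
        have hv := (Finset.mem_filter.1 hx).2
        simp only at hv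
        have e1 := hlow r' c' (by omega)
        have e2 := hlastd r' c' hv
        have e3 := T.inShape_of_entry (r := r') (c := c') (by omega)
        obtain rfl : r' = d₁ := by omega
        simp only [Finset.mem_product, Finset.mem_singleton, Finset.mem_Ico, true_and]
        unfold inShape at e3
        omega
      have := Finset.card_le_card hsubset
      rw [entryCount, h.be_lt _ hlt] at hcard
      rw [hcard] at this
      simp at this
      omega
  have hcol : ∀ j, 1 ≤ j → j ≤ p → T.entry (b + j) (b + s) = j := fun j h1 h2 =>
    (hE2 j h1 h2 _ _).2 (by omega)
  have hnew : T.entry b (b + s) = 0 := T.zero_outside _ _ h.not_inShape_new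
  have hcount : ∀ (F : Finset (ℕ × ℕ)) (k : ℕ),
      entryCount F (shiftEntry b s p d₁ d₂ T.entry) (k + 1) +
          (if (b + (k + 1), b + s) ∈ F ∧ k + 1 ≤ p then 1 else 0) +
          (if (d₁, d₂) ∈ F ∧ k = p then 1 else 0) =
        entryCount F T.entry (k + 1) + (if (b + k, b + s) ∈ F ∧ k ≤ p then 1 else 0) +
          (if (d₁, d₂) ∈ F ∧ k = 0 then 1 else 0) := by
    intro F k
    rw [entryCount_eq_sum, entryCount_eq_sum, ← sum_ite_eq_and, ← sum_ite_eq_and,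
      ← sum_ite_eq_and, ← sum_ite_eq_and, ← Finset.sum_add_distrib, ← Finset.sum_add_distrib,
      ← Finset.sum_add_distrib, ← Finset.sum_add_distrib]
    refine Finset.sum_congr rfl fun x _ => ?_
    obtain ⟨r, c⟩ := x
    simp only [Prod.mk.injEq, shiftEntry]
    by_cases hx : c = b + s ∧ b ≤ r ∧ r ≤ b + p
    · obtain ⟨rfl, hr1, hr2⟩ := hx
      obtain ⟨j, rfl⟩ := Nat.exists_eq_add_of_le hr1
      have hv : T.entry (b + j) (b + s) = j := by
        rcases Nat.eq_zero_or_pos j with rfl | hj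
        · exact hnew
        · exact hcol j hj (by omega)
      rw [hv]
      have : b + j ≠ d₁ := by omega
      simp only [this, true_and, and_true, false_and, if_false]
      split_ifs <;> omega
    · rw [if_neg hx]
      by_cases hxd : r = d₁ ∧ c = d₂
      · obtain ⟨rfl, rfl⟩ := hxd
        rw [hdv]
        simp only [true_and]
        split_ifs <;> omega
      · simp only [hxd, false_and, if_false]
        split_ifs <;> omega
  refine ⟨d₁, d₂, hd1, hdv, LRTableau.ofEntryCount hB (shiftEntry b s p d₁ d₂ T.entry)
    ?_ ?_ ?_ ?_ ?_ ?_, rfl⟩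
  · intro r c hs
    have hs1 := hs
    rw [h.inShape_iff] at hs1
    push Not at hs1
    have : ¬ (c = b + s ∧ b ≤ r ∧ r ≤ b + p) := by
      rintro ⟨rfl, hr1, hr2⟩
      rcases hr1.eq_or_lt with rfl | hlt
      · exact hs1.2 rfl rfl
      · apply hs1.1
        apply T.inShape_of_entry
        obtain ⟨j, rfl⟩ := Nat.exists_eq_add_of_le hr1
        rw [hcol j (by omega) (by omega)]
        omega
    rw [shiftEntry, if_neg this, if_neg]
    · exact T.zero_outside _ _ hs1.1
    · rintro ⟨rfl, rfl⟩
      exact hs1.1 hds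
  · intro r c hs
    unfold shiftEntry
    split_ifs with h1 h2
    · omega
    · exact le_rfl
    · refine T.one_le _ _ (((h.inShape_iff r c).1 hs).resolve_right ?_)
      rintro ⟨rfl, rfl⟩
      exact h1 ⟨rfl, le_rfl, by omega⟩
  · intro r c₁ c₂ hc hs1 hs2
    have hlamr := hlam0 r
    rcases hc.eq_or_lt with rfl | hc
    · exact le_rfl
    have hc1 : c₁ ≠ b + s := by unfold inShape at hs2; omega
    have hs1' := ((h.inShape_iff r c₁).1 hs1).resolve_right (by omega)
    have hs2' : inShape lam al r c₂ := by unfold inShape at *; omega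
    have hle := T.row_weak _ _ _ hc.le hs1' hs2'
    have hone := T.one_le _ _ hs1'
    have hone2 := T.one_le _ _ hs2'
    unfold shiftEntry
    rw [if_neg fun hx : c₁ = b + s ∧ _ => hc1 hx.1]
    by_cases h1 : r = d₁ ∧ c₁ = d₂
    · rw [if_pos h1]
      split_ifs <;> omega
    rw [if_neg h1]
    split_ifs with h2 h3
    · obtain ⟨rfl, hr1, hr2⟩ := h2
      obtain ⟨j, rfl⟩ := Nat.exists_eq_add_of_le hr1
      rcases Nat.eq_zero_or_pos j with rfl | hj
      · have := h.not_inShape_new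
        contradiction
      · rw [hcol j hj (by omega)] at hle
        omega
    · obtain ⟨rfl, rfl⟩ := h3
      have := hhigh _ _ hs1' hd1
      have := hlastd r c₁ (by omega)
      omega
    · exact hle
  · intro r₁ r₂ c hr hs1 hs2
    have hbr : b ≤ r₁ := by
      by_contra hlt
      have e1 := h.top r₁ (by omega)
      have e2 := hlam0 r₁
      have e3 := h.al' r₁
      rw [if_neg (by omega)] at e3
      unfold inShape at hs1
      omega
    have hs2' := (h.inShape_low (c := c) (show b < r₂ by omega)).1 hs2
    have h2d : ¬ (r₂ = d₁ ∧ c = d₂) := by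
      rintro ⟨rfl, rfl⟩
      exact habove _ hr hs1
    by_cases hc : c = b + s
    · have hr2 : r₂ ≤ b + p := by
        by_contra hlt
        have := h.part.1 (show b + p + 1 ≤ r₂ by omega)
        unfold inShape at hs2'
        omega
      unfold shiftEntry
      rw [if_pos (by omega), if_pos (by omega)]
      omega
    · have hs1' := ((h.inShape_iff r₁ c).1 hs1).resolve_right (by omega)
      have hlt := T.col_strict _ _ _ hr hs1' hs2'
      have hone := T.one_le _ _ hs1'
      unfold shiftEntry
      rw [if_neg fun hx : c = b + s ∧ b ≤ r₁ ∧ _ => hc hx.1,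
        if_neg fun hx : c = b + s ∧ b ≤ r₂ ∧ _ => hc hx.1, if_neg h2d]
      split_ifs with h1
      · omega
      · exact hlt
  · intro k
    have hB1 : ∀ j, j ≤ p → (b + j, b + s) ∈ B := by
      intro j hj
      refine hB _ _ ?_
      rcases Nat.eq_zero_or_pos j with rfl | hj1
      · exact h.lt_row
      · have := hp j hj1 hj
        omega
    have hc := hcount B k
    rw [T.entryCount_box hB] at hc
    have e1 : ((b + (k + 1), b + s) ∈ B ∧ k + 1 ≤ p) ↔ k + 1 ≤ p :=
      ⟨fun hx => hx.2, fun hx => ⟨hB1 _ hx, hx⟩⟩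
    have e2 : ((b + k, b + s) ∈ B ∧ k ≤ p) ↔ k ≤ p :=
      ⟨fun hx => hx.2, fun hx => ⟨hB1 _ hx, hx⟩⟩
    simp only [e1, e2, hdB, true_and] at hc
    rw [h.be']
    split_ifs at hc ⊢ with h1 h2 h3 h4 h5 <;> subst_vars <;> omega
  · intro r c k
    set F := B.filter (readBefore r c) with hF
    have hN := T.lattice_entryCount hB r c k
    rw [← hF] at hN
    have hc1 := hcount F k
    have hc2 := hcount F (k + 1)
    have hmemF : ∀ j, j ≤ p → ((b + j, b + s) ∈ F ↔ b + j < r ∨ (b + j = r ∧ c ≤ b + s)) := by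
      intro j hj
      rw [hF, Finset.mem_filter, readBefore]
      simp only [and_iff_right_iff_imp]
      intro _
      refine hB _ _ ?_
      rcases Nat.eq_zero_or_pos j with rfl | hj1
      · exact h.lt_row
      · have := hp j hj1 hj
        omega
    have hdF : (d₁, d₂) ∈ F ↔ d₁ < r ∨ (d₁ = r ∧ c ≤ d₂) := by
      rw [hF, Finset.mem_filter, readBefore]
      simp [hdB]
    have hposF : ∀ j, 1 ≤ j → j ≤ p → (1 ≤ entryCount F T.entry j ↔ (b + j, b + s) ∈ F) := by
      intro j hj1 hjp
      constructor
      · intro hpos'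
        obtain ⟨r', c', hm, hv⟩ := exists_of_entryCount_pos hpos'
        rw [hF, Finset.mem_filter, readBefore] at hm
        have := (hE2 j hj1 hjp r' c').1 hv
        rw [hmemF j hjp]
        simp only at hm
        omega
      · intro hm
        exact entryCount_pos hm (hcol j hj1 hjp)
    have hposp : 1 ≤ entryCount F T.entry (p + 1) → b + p < r := by
      intro hpos'
      obtain ⟨r', c', hm, hv⟩ := exists_of_entryCount_pos hpos'
      have := hlow r' c' (by omega)
      rw [hF, Finset.mem_filter, readBefore] at hm
      simp only at hm
      omega
    rcases lt_trichotomy (k + 1) p with hkp | hkp | hkp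
    · have m0 := hmemF k (by omega)
      have m1 := hmemF (k + 1) (by omega)
      have m2 := hmemF (k + 2) (by omega)
      have q1 := hposF (k + 1) (by omega) (by omega)
      have q2 := hposF (k + 2) (by omega) (by omega)
      rw [show k + 1 + 1 = k + 2 from rfl] at hc2
      simp only [m0, m1, m2] at hc1 hc2 q1 q2
      rw [if_neg (by omega : ¬ (_ ∧ k = p))] at hc1
      rw [if_neg (by omega : ¬ (_ ∧ k + 1 = p)), if_neg (by omega : ¬ (_ ∧ k + 1 = 0))] at hc2
      split_ifs at hc1 hc2 <;> omega
    · subst hkp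
      have m0 := hmemF k (by omega)
      have m1 := hmemF (k + 1) (by omega)
      have q1 := hposF (k + 1) (by omega) (by omega)
      have q3 : (d₁, d₂) ∉ F → b + (k + 1) < r →
          entryCount F T.entry (k + 2) + 1 ≤ entryCount F T.entry (k + 1) := by
        intro hdn hr
        have e1 : entryCount F T.entry (k + 1) = s := by
          rw [← h.be_lt k (by omega), ← T.entryCount_box hB k]
          unfold entryCount
          congr 1
          ext ⟨r', c'⟩
          simp only [hF, Finset.mem_filter, readBefore]
          constructor
          · rintro ⟨⟨a1, a2⟩, a3⟩
            exact ⟨a1, a3⟩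
          · rintro ⟨a1, a3⟩
            have := (hE2 (k + 1) (by omega) le_rfl r' c').1 a3
            exact ⟨⟨a1, by omega⟩, a3⟩
        have e2 : entryCount F T.entry (k + 2) < entryCount B T.entry (k + 2) := by
          refine Finset.card_lt_card ?_
          rw [Finset.ssubset_iff_of_subset (Finset.filter_subset_filter _
            (Finset.filter_subset _ _))]
          exact ⟨(d₁, d₂), hd, fun hm => hdn (Finset.mem_filter.1 hm).1⟩
        rw [T.entryCount_box hB (k + 1)] at e2
        omega
      rw [show k + 1 + 1 = k + 2 from rfl] at hc2 hposp
      simp only [m0, m1, hdF, and_true] at hc1 hc2 q1 q3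
      rw [if_neg (by omega : ¬ (_ ∧ k = k + 1))] at hc1
      rw [if_neg (by omega : ¬ (_ ∧ k + 1 + 1 ≤ k + 1)),
        if_neg (by omega : ¬ (_ ∧ k + 1 = 0))] at hc2
      split_ifs at hc1 hc2 <;> omega
    · rw [show k + 1 + 1 = k + 2 from rfl] at hc2
      rw [if_neg (by omega : ¬ (_ ∧ k + 1 ≤ p))] at hc1
      rw [if_neg (by omega : ¬ (_ ∧ k + 2 ≤ p)), if_neg (by omega : ¬ (_ ∧ k + 1 = p)),
        if_neg (by omega : ¬ (_ ∧ k + 1 ≤ p)), if_neg (by omega : ¬ (_ ∧ k + 1 = 0))] at hc2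
      by_cases hkp' : k = p
      · subst hkp'
        have m0 := hmemF k le_rfl
        simp only [m0, hdF] at hc1
        split_ifs at hc1 <;> omega
      · rw [if_neg (by omega : ¬ (_ ∧ k = p)), if_neg (by omega : ¬ (_ ∧ k ≤ p)),
          if_neg (by omega : ¬ (_ ∧ k = 0))] at hc1
        omega

theorem natCard_le (h : BoxRemoval s b lam al al' be be') :
    Nat.card (LRTableau lam al be) ≤ Nat.card (LRTableau lam al' be') := by
  have := LRTableau.finite_s14 (al := al') (be := be') h.part
  have hpos := h.pos
  have hgood : (∀ T : LRTableau lam al be, T.entry (b + 1) (b + s) ≠ 1) →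
      Nat.card (LRTableau lam al be) ≤ Nat.card (LRTableau lam al' be') := by
    intro hne
    choose f hf using fun T => h.exists_add_one T (hne T)
    refine Nat.card_le_card_of_injective f fun T U hTU => ?_
    refine LRTableau.ext_entry (funext fun r => funext fun c => ?_)
    have := congrFun (congrFun ((hf T).symm.trans ((congrArg _ hTU).trans (hf U))) r) c
    by_cases hx : r = b ∧ c = b + s
    · obtain ⟨rfl, rfl⟩ := hx
      rw [T.zero_outside _ _ h.not_inShape_new, U.zero_outside _ _ h.not_inShape_new]
    · simpa [hx] using this
  rcases Nat.lt_or_ge (b + 1 + s) (lam 0) with h0 | h0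
  · refine hgood fun T hT => ?_
    obtain ⟨B, hB⟩ := exists_box h.part
    have hcard := T.entryCount_box hB 0
    rw [h.be_lt 0 hpos, entryCount] at hcard
    have hs := T.inShape_of_entry (r := b + 1) (c := b + s) (by omega)
    have hlow := h.low (b + 1) (by omega)
    have hsubset : insert (0, b + 1 + s) ({b + 1} ×ˢ Finset.Ico (b + 1) (b + 1 + s)) ⊆
        B.filter fun x => T.entry x.1 x.2 = 0 + 1 := by
      rintro ⟨r, c⟩ hx
      simp only [Finset.mem_insert, Prod.mk.injEq, Finset.mem_product, Finset.mem_singleton,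
        Finset.mem_Ico] at hx
      rcases hx with ⟨rfl, rfl⟩ | ⟨rfl, hc⟩
      · have hs0 : inShape lam al 0 (b + 1 + s) := ⟨(h.top 0 (by omega)).le, h0⟩
        have e1 := T.entry_add_le h.part 0 (by simp) _ _ hs0
        have e2 := T.one_le _ _ hs0
        refine Finset.mem_filter.2 ⟨hB _ _ hs0.2, ?_⟩
        dsimp only
        omega
      · have hs1 : inShape lam al (b + 1) c := by unfold inShape at *; omega
        have e1 := T.row_weak _ _ _ (show c ≤ b + s by omega) hs1 hs
        have e2 := T.one_le _ _ hs1
        refine Finset.mem_filter.2 ⟨hB _ _ hs1.2, ?_⟩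
        dsimp only
        omega
    have hle := Finset.card_le_card hsubset
    rw [hcard, Finset.card_insert_of_notMem (by simp)] at hle
    simp at hle
  · have hex : ∃ p, lam (b + p + 1) < b + 1 + s := by
      obtain ⟨hanti, N, hN⟩ := h.part
      have := hanti (show N ≤ b + N + 1 by omega)
      exact ⟨N, by omega⟩
    classical
    obtain ⟨p, hlast, hmin⟩ : ∃ p, lam (b + p + 1) < b + 1 + s ∧
        ∀ q < p, ¬ lam (b + q + 1) < b + 1 + s :=
      ⟨Nat.find hex, Nat.find_spec hex, fun q hq => Nat.find_min hex hq⟩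
    rcases Nat.eq_zero_or_pos p with rfl | hp1
    · refine hgood fun T hT => ?_
      have hs := T.inShape_of_entry (r := b + 1) (c := b + s) (by omega)
      simp only [Nat.add_zero] at hlast
      unfold inShape at hs
      omega
    · have hp : ∀ j, 1 ≤ j → j ≤ p → b + 1 + s ≤ lam (b + j) := by
        intro j hj1 hjp
        have := hmin (j - 1) (by omega)
        rw [show b + (j - 1) + 1 = b + j by omega] at this
        omega
      choose d₁ d₂ hd hdv f hf using fun T => h.exists_shift T h0 p hp1 hp hlast
      have hinv : ∀ T r c, T.entry r c = if c = b + s ∧ b ≤ r ∧ r ≤ b + p then r - b else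
          if b + 1 < r ∧ (f T).entry r c = 1 then p + 1 else (f T).entry r c := by
        intro T r c
        rw [hf T]
        have hE := h.entry_eq_iff T h0 p hp
        unfold shiftEntry
        by_cases hx : c = b + s ∧ b ≤ r ∧ r ≤ b + p
        · simp only [if_pos hx]
          obtain ⟨rfl, hr1, hr2⟩ := hx
          rcases hr1.eq_or_lt with rfl | hlt
          · rw [T.zero_outside _ _ h.not_inShape_new, Nat.sub_self]
          · exact ((hE (r - b) (by omega) (by omega)).2 _ _).2 (by omega)
        · simp only [if_neg hx]
          by_cases hxd : r = d₁ T ∧ c = d₂ T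
          · have := hd T
            rw [if_pos hxd, if_pos ⟨by omega, rfl⟩, hxd.1, hxd.2, hdv]
          · rw [if_neg hxd, if_neg]
            rintro ⟨hr, hv⟩
            have := ((hE 1 le_rfl hp1).2 _ _).1 hv
            omega
      refine Nat.card_le_card_of_injective f fun T U hTU => ?_
      refine LRTableau.ext_entry (funext fun r => funext fun c => ?_)
      rw [hinv T, hinv U, hTU]

end BoxRemoval

/-- If the rows of a skew shape before row `r₀` are empty and the rows after that have lengths
`be 0 ≥ be 1 ≥ …`, then filling row `r₀ + k` with `k + 1` gives a Littlewood–Richardson tableau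
of content `be`. -/
theorem LRTableau.nonempty_of_rows {lam al be : ℕ → ℕ} (hlam : IsPartition lam)
    (hbe : Antitone be) (r₀ : ℕ) (hempty : ∀ r < r₀, ∀ c, ¬ inShape lam al r c)
    (hrow : ∀ k, lam (r₀ + k) = al (r₀ + k) + be k) : Nonempty (LRTableau lam al be) := by
  classical
  obtain ⟨B, hB⟩ := exists_box hlam
  have hr₀ : ∀ r c, inShape lam al r c → r₀ ≤ r := fun r c hs =>
    not_lt.1 fun hlt => hempty r hlt c hs
  have hval : ∀ r c k, (if inShape lam al r c then r + 1 - r₀ else 0) = k + 1 ↔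
      r = r₀ + k ∧ al r ≤ c ∧ c < lam r := by
    intro r c k
    split_ifs with hs
    · have := hr₀ r c hs
      unfold inShape at hs
      omega
    · exact ⟨fun h => h.elim, fun h => absurd h.2 hs⟩
  have hcontent : ∀ k, entryCount B (fun r c => if inShape lam al r c then r + 1 - r₀ else 0)
      (k + 1) = be k := by
    intro k
    have : (B.filter fun x => (if inShape lam al x.1 x.2 then x.1 + 1 - r₀ else 0) = k + 1) =
        {r₀ + k} ×ˢ Finset.Ico (al (r₀ + k)) (lam (r₀ + k)) := by
      ext ⟨r, c⟩
      simp only [Finset.mem_filter, hval, Finset.mem_product, Finset.mem_singleton,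
        Finset.mem_Ico]
      constructor
      · rintro ⟨-, rfl, h⟩
        exact ⟨rfl, h⟩
      · rintro ⟨rfl, h⟩
        exact ⟨hB _ _ h.2, rfl, h⟩
    rw [entryCount, this, Finset.card_product, Finset.card_singleton, Nat.card_Ico, hrow]
    omega
  refine ⟨LRTableau.ofEntryCount hB
    (fun r c => if inShape lam al r c then r + 1 - r₀ else 0) ?_ ?_ ?_ ?_ hcontent ?_⟩
  · intro r c hs
    exact if_neg hs
  · intro r c hs
    have := hr₀ r c hs
    rw [if_pos hs]
    omega
  · intro r c₁ c₂ _ h1 h2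
    rw [if_pos h1, if_pos h2]
  · intro r₁ r₂ c hr h1 h2
    have := hr₀ _ _ h1
    rw [if_pos h1, if_pos h2]
    omega
  · intro r c k
    rcases Nat.lt_or_ge (r₀ + k) r with hlt | hge
    · calc _ ≤ entryCount B (fun r c => if inShape lam al r c then r + 1 - r₀ else 0) (k + 2) :=
            Finset.card_le_card (Finset.filter_subset_filter _ (Finset.filter_subset _ _))
        _ = be (k + 1) := hcontent (k + 1)
        _ ≤ be k := hbe (Nat.le_succ k)
        _ = _ := (hcontent k).symm
        _ ≤ _ := by
            refine Finset.card_le_card fun x hx => ?_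
            have hx' := Finset.mem_filter.1 hx
            have := ((hval _ _ _).1 hx'.2).1
            exact Finset.mem_filter.2 ⟨Finset.mem_filter.2 ⟨hx'.1, Or.inl (by omega)⟩, hx'.2⟩
    · rw [entryCount_eq_zero]
      · exact Nat.zero_le _
      · intro r' c' hm hv
        have h1 := ((hval r' c' (k + 1)).1 hv).1
        have h2 := (Finset.mem_filter.1 hm).2
        simp only [readBefore] at h2
        omega

theorem LRTableau.sum_rows_le {lam al be : ℕ → ℕ} (T : LRTableau lam al be)
    (hlam : IsPartition lam) (r₀ : ℕ) (hempty : ∀ r < r₀, ∀ c, ¬ inShape lam al r c) (n : ℕ) :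
    ∑ i ∈ Finset.range n, (lam (r₀ + i) - al (r₀ + i)) ≤ ∑ k ∈ Finset.range n, be k := by
  obtain ⟨B, hB⟩ := exists_box hlam
  set C := (Finset.range n).sigma fun i => Finset.Ico (al (r₀ + i)) (lam (r₀ + i)) with hC
  have hmem : ∀ x, x ∈ C ↔ x.1 < n ∧ inShape lam al (r₀ + x.1) x.2 := by
    intro x
    simp [hC, inShape]
  have hmaps : ∀ x ∈ C, T.entry (r₀ + x.1) x.2 - 1 ∈ Finset.range n := by
    intro x hx
    have hx' := (hmem x).1 hx
    have := T.entry_add_le hlam r₀ hempty _ _ hx'.2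
    rw [Finset.mem_range]
    omega
  calc _ = C.card := by simp [hC]
    _ = _ := Finset.card_eq_sum_card_fiberwise hmaps
    _ ≤ _ := by
      refine Finset.sum_le_sum fun k _ => ?_
      rw [← T.entryCount_box hB k]
      refine Finset.card_le_card_of_injOn (fun x => (r₀ + x.1, x.2)) ?_ ?_
      · intro x hx
        have hx' := Finset.mem_filter.1 hx
        have hs := ((hmem x).1 hx'.1).2
        have := T.one_le _ _ hs
        exact Finset.mem_filter.2 ⟨hB _ _ hs.2, by dsimp only; omega⟩
      · rintro ⟨i, c⟩ _ ⟨i', c'⟩ _ heq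
        simp only [Prod.mk.injEq] at heq
        obtain ⟨h1, rfl⟩ := heq
        obtain rfl : i = i' := by omega
        rfl

theorem plen_eq {f : ℕ → ℕ} {n : ℕ} (h0 : f n = 0) (h : ∀ i < n, f i ≠ 0) : plen f = n :=
  le_antisymm (Nat.sInf_le h0) (le_csInf ⟨n, h0⟩ fun i hi => not_lt.1 fun hlt => h i hlt hi)

namespace IsPartition

variable {f : ℕ → ℕ}

theorem eq_zero (hf : IsPartition f) {i : ℕ} (hi : plen f ≤ i) : f i = 0 := by
  have h0 : f (plen f) = 0 := Nat.sInf_mem (s := {n | f n = 0}) hf.2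
  exact Nat.le_zero.1 (h0 ▸ hf.1 hi)

theorem psize_eq (hf : IsPartition f) {n : ℕ} (hn : f n = 0) :
    psize f = ∑ i ∈ Finset.range n, f i := by
  have hle : plen f ≤ n := Nat.sInf_le hn
  refine Finset.sum_subset (Finset.range_subset_range.2 hle) fun i _ hi => hf.eq_zero ?_
  simpa using hi

theorem lt_conjP_iff_s14 (hf : IsPartition f) (i k : ℕ) : i < conjP f k ↔ k < f i := by
  classical
  obtain ⟨hanti, N, hN⟩ := hf
  have hex : ∃ n, f n ≤ k := ⟨N, by omega⟩
  have hiff : ∀ j, k < f j ↔ j < Nat.find hex := by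
    intro j
    constructor
    · intro hj
      by_contra hlt
      have := hanti (not_lt.1 hlt)
      have := Nat.find_spec hex
      omega
    · exact fun hj => not_le.1 (Nat.find_min hex hj)
  have hcard : conjP f k = Nat.find hex := by
    rw [conjP, Nat.subtype_card (Finset.range (Nat.find hex)) fun j => by
      rw [Finset.mem_range, hiff], Finset.card_range]
  rw [hcard, hiff]

theorem antitone_conjP (hf : IsPartition f) : Antitone (conjP f) := by
  intro k l hkl
  refine le_of_forall_lt fun i hi => ?_
  rw [hf.lt_conjP_iff_s14] at hi ⊢
  omega

theorem conjP_le (hf : IsPartition f) {n : ℕ} (hn : f n = 0) (k : ℕ) : conjP f k ≤ n := by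
  by_contra hlt
  have := (hf.lt_conjP_iff_s14 n k).1 (not_le.1 hlt)
  omega

end IsPartition

theorem LRcoeff_le_of_append_one {s m : ℕ} (hs : 1 ≤ s) {alpha nu mu : ℕ → ℕ}
    (halpha : IsPartition alpha) (hane : alpha 0 ≠ 0) (hlen : plen alpha ≤ s)
    (hnu : ∀ j, nu j = squareP s j + alpha j) (hmu : ∀ j, mu j = squareP1 s j + alpha j)
    (hnuP : IsPartition nu) (hmuP : IsPartition mu) (hm : mu 0 + (s + 1) ≤ m)
    {lam : ℕ → ℕ} (hlam : IsPartition lam) :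
    LRcoeff lam (complP m nu) (conjP nu) ≤ LRcoeff lam (complP m mu) (conjP mu) := by
  have hz : ∀ i, s ≤ i → alpha i = 0 := fun i hi => halpha.eq_zero (hlen.trans hi)
  have hnu1 : ∀ i, i < s → nu i = s + alpha i := fun i hi => by rw [hnu, squareP, if_pos hi]
  have hnu2 : ∀ i, s ≤ i → nu i = 0 := fun i hi => by
    rw [hnu, squareP, if_neg (by omega), hz i hi]
  have hmunu : ∀ i, mu i = if i = s then 1 else nu i := by
    intro i
    rw [hmu, hnu, squareP1, squareP]
    have := hz i
    split_ifs <;> omega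
  have hmu0 : mu 0 = s + alpha 0 := by rw [hmunu, if_neg (by omega), hnu1 0 (by omega)]
  obtain ⟨b, rfl⟩ : ∃ b, m = b + 1 + s := ⟨m - 1 - s, by omega⟩
  have hal' : ∀ r, complP (b + 1 + s) mu r =
      if r = b then b + s else complP (b + 1 + s) nu r := by
    intro r
    unfold complP
    have := hmunu (b + 1 + s - 1 - r)
    split_ifs at * <;> omega
  have hbe_lt : ∀ k < s, conjP nu k = s := by
    intro k hk
    refine eq_of_forall_lt_iff fun i => ?_
    rw [hnuP.lt_conjP_iff_s14]
    rcases Nat.lt_or_ge i s with hi | hi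
    · rw [hnu1 i hi]; omega
    · rw [hnu2 i hi]; omega
  unfold LRcoeff
  by_cases hsub : subP (complP (b + 1 + s) nu) lam
  · have hsub' : subP (complP (b + 1 + s) mu) lam := by
      intro r
      have h1 := hsub r
      rw [hal']
      split_ifs with hr
      · have := hnu2 (b + 1 + s - 1 - r) (by omega)
        rw [complP, this, if_pos (by omega)] at h1
        omega
      · exact h1
    rw [if_pos hsub, if_pos hsub']
    refine BoxRemoval.natCard_le (s := s) (b := b) ⟨hs, by omega, hlam, ?_, hsub, ?_, ?_, ?_,
      hbe_lt, ?_, hnuP.conjP_le (hnu2 s le_rfl) s, hal', ?_⟩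
    · intro i j hij
      unfold complP
      have := hnuP.1 (show b + 1 + s - 1 - j ≤ b + 1 + s - 1 - i by omega)
      split_ifs <;> omega
    · intro r hr
      rw [complP, if_pos (by omega), hnu2 _ (by omega)]
      rfl
    · intro r hr
      unfold complP
      split_ifs
      · rw [hnu1 _ (by omega)]; omega
      · omega
    · exact if_neg (lt_irrefl _)
    · rw [Nat.succ_le_iff, hnuP.lt_conjP_iff_s14, hnu1 0 (by omega)]
      omega
    · intro k
      refine eq_of_forall_lt_iff fun i => ?_
      rw [hmuP.lt_conjP_iff_s14, hmunu]
      have h1 := hbe_lt 0 (by omega)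
      have h2 := hnuP.lt_conjP_iff_s14 i k
      have h3 := hnu2 i
      have h4 := hnu1 i
      split_ifs <;> omega
  · rw [if_neg hsub]
    exact Nat.zero_le _

theorem not_covers_of_eq_zero {s : ℕ} {alpha nu mu : ℕ → ℕ}
    (halpha : IsPartition alpha) (hlen : plen alpha ≤ s)
    (hnu : ∀ j, nu j = squareP s j + alpha j) (hnuP : IsPartition nu) (hmuP : IsPartition mu)
    (hsub : subP nu mu) (hsz : psize mu = psize nu + 1) (hmus : mu s = 0) :
    ¬ Covers mu nu := by
  intro hcov
  have hz : ∀ i, s ≤ i → alpha i = 0 := fun i hi => halpha.eq_zero (hlen.trans hi)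
  have hnu1 : ∀ i, i < s → nu i = s + alpha i := fun i hi => by rw [hnu, squareP, if_pos hi]
  have hnu2 : ∀ i, s ≤ i → nu i = 0 := fun i hi => by
    rw [hnu, squareP, if_neg (by omega), hz i hi]
  have hmu2 : ∀ i, s ≤ i → mu i = 0 := fun i hi => Nat.le_zero.1 (hmus ▸ hmuP.1 hi)
  have hcle : ∀ k, conjP alpha k ≤ s := halpha.conjP_le (hz s le_rfl)
  obtain ⟨b, hb⟩ : ∃ b, b = mu 0 + plen mu + s + alpha 0 := ⟨_, rfl⟩
  have hal0 : ∀ i, alpha i ≤ alpha 0 := fun i => halpha.1 (Nat.zero_le i)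
  have hmu0 : ∀ i, mu i ≤ mu 0 := fun i => hmuP.1 (Nat.zero_le i)
  set lam := appendAfter (b + s) (complP (b + s) alpha) (conjP alpha) with hlam_def
  have hlam1 : ∀ r, r < b + s → lam r = b + s - alpha (b + s - 1 - r) := fun r hr => by
    rw [hlam_def, appendAfter, if_pos hr, complP, if_pos hr]
  have hlam2 : ∀ k, lam (b + s + k) = conjP alpha k := fun k => by
    rw [hlam_def, appendAfter, if_neg (by omega), Nat.add_sub_cancel_left]
  have hlam : IsPartition lam := by
    constructor
    · intro i j hij
      rcases Nat.lt_or_ge j (b + s) with hj | hj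
      · rw [hlam1 j hj, hlam1 i (by omega)]
        have := halpha.1 (show b + s - 1 - j ≤ b + s - 1 - i by omega)
        omega
      · obtain ⟨l, rfl⟩ := Nat.exists_eq_add_of_le hj
        rw [hlam2]
        rcases Nat.lt_or_ge i (b + s) with hi | hi
        · rw [hlam1 i hi]
          have h1 := hal0 (b + s - 1 - i)
          have h2 := hcle l
          omega
        · obtain ⟨k, rfl⟩ := Nat.exists_eq_add_of_le hi
          rw [hlam2]
          exact halpha.antitone_conjP (by omega)
    · refine ⟨b + s + alpha 0, ?_⟩
      rw [hlam2]
      refine Nat.le_zero.1 (not_lt.1 fun h => ?_)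
      exact lt_irrefl _ ((halpha.lt_conjP_iff_s14 _ _).1 h)
  have hempty : ∀ {f : ℕ → ℕ}, (∀ i, s ≤ i → f i = 0) →
      ∀ r < b, ∀ c, ¬ inShape lam (complP (b + s) f) r c := by
    intro f hf r hr c hs
    rw [inShape, hlam1 r (by omega), complP, if_pos (by omega), hf _ (by omega)] at hs
    omega
  have hrow : ∀ k, lam (b + k) = complP (b + s) nu (b + k) + conjP nu k := by
    intro k
    have hconj : ∀ n, (∀ i, i < n ↔ k < nu i) → conjP nu k = n := fun n hn =>
      eq_of_forall_lt_iff fun i => by rw [hnuP.lt_conjP_iff_s14, hn]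
    unfold complP
    rcases Nat.lt_or_ge k s with hk | hk
    · rw [hconj s fun i => ?_, hlam1 _ (by omega), if_pos (by omega), hnu1 _ (by omega)]
      · have := hal0 (b + s - 1 - (b + k))
        omega
      · rcases Nat.lt_or_ge i s with hi | hi
        · rw [hnu1 i hi]; omega
        · rw [hnu2 i hi]; omega
    · obtain ⟨j, rfl⟩ := Nat.exists_eq_add_of_le hk
      rw [if_neg (by omega), ← Nat.add_assoc, hlam2, Nat.zero_add]
      refine (hconj _ fun i => ?_).symm
      rw [halpha.lt_conjP_iff_s14]
      rcases Nat.lt_or_ge i s with hi | hi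
      · rw [hnu1 i hi]; omega
      · rw [hnu2 i hi, hz i hi]; omega
  have hsubP : subP (complP (b + s) nu) lam := by
    intro r
    rcases Nat.lt_or_ge r b with hr | hr
    · rw [hlam1 r (by omega), hz _ (by omega), complP, if_pos (by omega)]
      omega
    · obtain ⟨k, rfl⟩ := Nat.exists_eq_add_of_le hr
      rw [hrow]
      exact Nat.le_add_right _ _
  have hle := hcov (b + s) (by omega) lam hlam
  have hpos : 0 < LRcoeff lam (complP (b + s) nu) (conjP nu) := by
    rw [LRcoeff, if_pos hsubP]
    have := LRTableau.nonempty_of_rows hlam hnuP.antitone_conjP b (hempty hnu2) hrow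
    have := LRTableau.finite_s14 (al := complP (b + s) nu) (be := conjP nu) hlam
    exact Nat.card_pos
  have hpos' := hpos.trans_le hle
  rw [LRcoeff] at hpos'
  split_ifs at hpos'
  · obtain ⟨T⟩ := (Nat.card_pos_iff.1 hpos').1
    have hsum := T.sum_rows_le hlam b (hempty hmu2) s
    have hrefl : ∑ i ∈ Finset.range s, (lam (b + i) - complP (b + s) mu (b + i)) =
        ∑ i ∈ Finset.range s, (mu i - alpha i) := by
      rw [← Finset.sum_range_reflect (fun i => mu i - alpha i)]
      refine Finset.sum_congr rfl fun i hi => ?_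
      rw [Finset.mem_range] at hi
      rw [hlam1 _ (by omega), complP, if_pos (by omega),
        show b + s - 1 - (b + i) = s - 1 - i by omega]
      have h1 := hmu0 (s - 1 - i)
      have h2 := hal0 (s - 1 - i)
      omega
    have hmusum : ∑ i ∈ Finset.range s, mu i =
        ∑ i ∈ Finset.range s, (mu i - alpha i) + ∑ i ∈ Finset.range s, alpha i := by
      rw [← Finset.sum_add_distrib]
      refine Finset.sum_congr rfl fun i _ => ?_
      have h1 := hsub i
      have h2 := hnu i
      omega
    have hnusum : ∑ i ∈ Finset.range s, nu i = s * s + ∑ i ∈ Finset.range s, alpha i := by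
      rw [Finset.sum_congr rfl fun i hi => hnu1 i (Finset.mem_range.1 hi),
        Finset.sum_add_distrib]
      simp
    have hbound : ∑ k ∈ Finset.range s, conjP mu k ≤ s * s := by
      simpa using Finset.sum_le_card_nsmul (Finset.range s) (conjP mu) s
        fun k _ => hmuP.conjP_le hmus k
    rw [hmuP.psize_eq hmus, hnuP.psize_eq (hnu2 s le_rfl)] at hsz
    omega
  · exact lt_irrefl _ hpos'

/-- for `ν = (s^s) + α` of type 2 with `β = ∅` and a partition `μ ⊇ ν`
with `|μ| = |ν| + 1`, `μ` covers `ν` if and only if `μ = (s^s, 1) + α = (ν, 1)`. -/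
theorem square_plus_alpha_cover (s : ℕ) (hs : 1 ≤ s) (alpha : ℕ → ℕ)
    (halpha : IsPartition alpha) (hane : alpha 0 ≠ 0) (hlen : plen alpha ≤ s)
    (mu : ℕ → ℕ) (hmu : IsPartition mu)
    (hsub : subP (fun j => squareP s j + alpha j) mu)
    (hsz : psize mu = psize (fun j => squareP s j + alpha j) + 1) :
    Covers mu (fun j => squareP s j + alpha j) ↔
      mu = fun j => squareP1 s j + alpha j := by
  have hz : ∀ i, s ≤ i → alpha i = 0 := fun i hi => halpha.eq_zero (hlen.trans hi)
  have hnuP : IsPartition (fun j => squareP s j + alpha j) := by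
    refine ⟨fun i j hij => ?_, s, by simp [squareP, hz s le_rfl]⟩
    have := halpha.1 hij
    dsimp only [squareP]
    split_ifs <;> omega
  constructor
  · intro hcov
    have hmus : mu s ≠ 0 := fun h0 =>
      not_covers_of_eq_zero halpha hlen (fun _ => rfl) hnuP hmu hsub hsz h0 hcov
    obtain ⟨N, hN⟩ := hmu.2
    have hsN : s < N := by
      by_contra hle
      have := hmu.1 (not_lt.1 hle)
      omega
    have hstep : ∀ i, squareP1 s i + alpha i =
        squareP s i + alpha i + if i = s then 1 else 0 := by
      intro i
      unfold squareP1 squareP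
      split_ifs <;> omega
    have hle : ∀ i ∈ Finset.range N, squareP1 s i + alpha i ≤ mu i := by
      intro i _
      have h1 := hsub i
      have h2 := hstep i
      dsimp only at h1
      split_ifs at h2 with hi
      · subst hi
        have : squareP i i = 0 := if_neg (lt_irrefl i)
        have := hz i le_rfl
        omega
      · omega
    have hsum : ∑ i ∈ Finset.range N, (squareP1 s i + alpha i) = ∑ i ∈ Finset.range N, mu i := by
      have hnuN : squareP s N + alpha N = 0 := Nat.le_zero.1 (hN ▸ hsub N)
      rw [← hmu.psize_eq hN, hsz, hnuP.psize_eq hnuN, Finset.sum_congr rfl fun i _ => hstep i,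
        Finset.sum_add_distrib]
      simp [hsN]
    funext i
    rcases Nat.lt_or_ge i N with hi | hi
    · exact ((Finset.sum_eq_sum_iff_of_le hle).1 hsum i (Finset.mem_range.2 hi)).symm
    · have h0 := hmu.1 hi
      have h1 := hz i (by omega)
      unfold squareP1
      rw [if_neg (by omega), if_neg (by omega)]
      omega
  · intro heq m hm lam hlam
    have hmu' : ∀ j, mu j = squareP1 s j + alpha j := fun j => congrFun heq j
    have hplen : plen mu = s + 1 := by
      refine plen_eq ?_ fun i hi => ?_
      · rw [hmu', hz _ (by omega)]
        simp [squareP1]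
      · rw [hmu']
        unfold squareP1
        split_ifs <;> omega
    exact LRcoeff_le_of_append_one hs halpha hane hlen (fun _ => rfl) hmu' hnuP hmu (hplen ▸ hm) hlam
end
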